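/- arXiv:1604.03155 — 7 statements merged into one kernel-verified Lean document; each statement's English description precedes it below -/
import Mathlib

section
/- Let f : ℝ² → ℂ be integrable and radially symmetric, i.e. there exists f₀ : [0,∞) → ℂ with f(x) = f₀(|x|) for all x. Then for every s ∈ ℝ², the Fourier transform F(s) = ∫_{ℝ²} e^{−i⟨s,x⟩} f(x) dx satisfies F(s) = 2π ∫₀^∞ J₀(|s| r) f₀(r) r dr, where J₀ is the Bessel function of the first kind of order zero. -/
open MeasureTheory RealInnerProductSpace

/-- The Bessel function of the first kind of integer order `n`, defined via its
integral representation `J_n(x) = (1/π) ∫₀^π cos(nθ − x sin θ) dθ`. -/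
noncomputable def besselJ (n : ℕ) (x : ℝ) : ℝ :=
  (1 / Real.pi) * ∫ θ in (0 : ℝ)..Real.pi, Real.cos (n * θ - x * Real.sin θ)

/-- The integral of `exp (-i a sin θ)` over a full period is `2π J₀(a)`. -/
theorem integral_exp_neg_I_mul_sin (a : ℝ) :
    ∫ θ in (-Real.pi)..Real.pi, Complex.exp (-Complex.I * ((a * Real.sin θ : ℝ) : ℂ)) =
      ((2 * Real.pi * besselJ 0 a : ℝ) : ℂ) := by
  have hint : ∀ b c : ℝ, IntervalIntegrable
      (fun θ : ℝ => Complex.exp (-Complex.I * ((a * Real.sin θ : ℝ) : ℂ))) volume b c :=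
    fun b c => Continuous.intervalIntegrable (by fun_prop) b c
  have hneg : ∫ θ in (-Real.pi)..0, Complex.exp (-Complex.I * ((a * Real.sin θ : ℝ) : ℂ)) =
      ∫ θ in (0 : ℝ)..Real.pi, Complex.exp (Complex.I * ((a * Real.sin θ : ℝ) : ℂ)) := by
    have h := intervalIntegral.integral_comp_neg (a := 0) (b := Real.pi)
      (fun θ : ℝ => Complex.exp (-Complex.I * ((a * Real.sin θ : ℝ) : ℂ)))
    rw [neg_zero] at h
    rw [← h]
    simp
  have hcos : ∀ θ : ℝ, Complex.exp (Complex.I * ((a * Real.sin θ : ℝ) : ℂ)) +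
      Complex.exp (-Complex.I * ((a * Real.sin θ : ℝ) : ℂ)) =
        ((2 * Real.cos (a * Real.sin θ) : ℝ) : ℂ) := by
    intro θ
    rw [Complex.ofReal_mul 2, Complex.ofReal_cos, Complex.cos]
    push_cast
    ring_nf
  rw [← intervalIntegral.integral_add_adjacent_intervals (hint _ 0) (hint 0 _), hneg,
    ← intervalIntegral.integral_add (Continuous.intervalIntegrable (by fun_prop) _ _) (hint _ _)]
  simp_rw [hcos]
  rw [intervalIntegral.integral_ofReal, intervalIntegral.integral_const_mul]
  have hJ : besselJ 0 a = (1 / Real.pi) * ∫ θ in (0 : ℝ)..Real.pi, Real.cos (a * Real.sin θ) := by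
    simp [besselJ]
  rw [hJ]
  congr 1
  field_simp

/-- Integrating a plane wave over a circle: the direction of the wave vector is irrelevant. -/
theorem integral_exp_neg_I_mul_cos_sub (a φ : ℝ) :
    ∫ θ in Set.Ioo (-Real.pi) Real.pi,
        Complex.exp (-Complex.I * ((a * Real.cos (θ - φ) : ℝ) : ℂ)) =
      ((2 * Real.pi * besselJ 0 a : ℝ) : ℂ) := by
  have hper : Function.Periodic
      (fun θ : ℝ => Complex.exp (-Complex.I * ((a * Real.sin θ : ℝ) : ℂ))) (2 * Real.pi) :=
    fun θ => by simp only [Real.sin_add_two_pi]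
  have hshift : ∀ θ : ℝ, Real.cos (θ - φ) = Real.sin (θ + (Real.pi / 2 - φ)) := by
    intro θ
    rw [← Real.sin_add_pi_div_two]
    ring_nf
  simp_rw [hshift]
  rw [← integral_Ioc_eq_integral_Ioo, ← intervalIntegral.integral_of_le (by linarith [Real.pi_pos]),
    intervalIntegral.integral_comp_add_right
      (fun θ : ℝ => Complex.exp (-Complex.I * ((a * Real.sin θ : ℝ) : ℂ))),
    ← integral_exp_neg_I_mul_sin]
  have h := hper.intervalIntegral_add_eq (-Real.pi + (Real.pi / 2 - φ)) (-Real.pi)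
  convert h using 2 <;> ring

/-- An integrable function on `ℂ` is integrable in polar coordinates. -/
theorem Complex.integrableOn_comp_polarCoord_symm {E : Type*} [NormedAddCommGroup E]
    [NormedSpace ℝ E] {g : ℂ → E} (hg : Integrable g) :
    IntegrableOn (fun p : ℝ × ℝ => p.1 • g (Complex.polarCoord.symm p)) polarCoord.target := by
  have hg' : Integrable (fun p : ℝ × ℝ => g (Complex.measurableEquivRealProd.symm p)) :=
    Complex.volume_preserving_equiv_real_prod.symm.integrable_comp_of_integrable hg
  have h := (integrableOn_image_iff_integrableOn_abs_det_fderiv_smul volume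
    polarCoord.open_target.measurableSet
    (fun p _ => (hasFDerivAt_polarCoord_symm p).hasFDerivWithinAt)
    polarCoord.symm.injOn _).1 (hg'.integrableOn (s := polarCoord.symm '' polarCoord.target))
  refine h.congr_fun (fun p hp => ?_) polarCoord.open_target.measurableSet
  have hp1 : 0 < p.1 := hp.1
  simp only [det_fderivPolarCoordSymm, abs_of_pos hp1,
    Complex.measurableEquivRealProd_symm_polarCoord_symm_apply]

/-- The real inner product on `ℂ` in polar coordinates. -/
theorem Complex.inner_polarCoord_symm (w : ℂ) (p : ℝ × ℝ) :
    ⟪w, Complex.polarCoord.symm p⟫ = ‖w‖ * p.1 * Real.cos (p.2 - w.arg) := by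
  rw [Complex.inner, Complex.polarCoord_symm_apply, Real.cos_sub]
  simp only [Complex.mul_re, Complex.mul_im, Complex.add_re, Complex.add_im, Complex.ofReal_re,
    Complex.ofReal_im, Complex.I_re, Complex.I_im, Complex.conj_re, Complex.conj_im]
  linear_combination -(p.1 * Real.cos p.2) * Complex.norm_mul_cos_arg w -
    p.1 * Real.sin p.2 * Complex.norm_mul_sin_arg w

/-- The Fourier integral over `ℂ` of a radial function as a Bessel integral. -/
theorem Complex.integral_exp_inner_mul_radial (f₀ : ℝ → ℂ)
    (hf : Integrable fun z : ℂ => f₀ ‖z‖) (w : ℂ) :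
    ∫ z : ℂ, Complex.exp (-Complex.I * ((⟪w, z⟫ : ℝ) : ℂ)) * f₀ ‖z‖ =
      ((2 * Real.pi : ℝ) : ℂ) *
        ∫ r in Set.Ioi (0 : ℝ), ((besselJ 0 (‖w‖ * r) : ℝ) : ℂ) * f₀ r * (r : ℂ) := by
  have hint : Integrable fun z : ℂ => Complex.exp (-Complex.I * ((⟪w, z⟫ : ℝ) : ℂ)) * f₀ ‖z‖ := by
    refine hf.bdd_mul (c := 1) (Continuous.aestronglyMeasurable (by fun_prop)) (.of_forall fun z => ?_)
    simp [Complex.norm_exp]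
  have hpolar := Complex.integrableOn_comp_polarCoord_symm hint
  rw [polarCoord_target, Measure.volume_eq_prod] at hpolar
  rw [← Complex.integral_comp_polarCoord_symm, polarCoord_target, Measure.volume_eq_prod,
    setIntegral_prod _ hpolar, ← integral_const_mul]
  refine setIntegral_congr_fun measurableSet_Ioi fun r hr => ?_
  have hr0 : (0 : ℝ) < r := hr
  simp only [Complex.inner_polarCoord_symm, Complex.norm_polarCoord_symm, abs_of_pos hr0]
  rw [integral_smul, integral_mul_const, integral_exp_neg_I_mul_cos_sub, Complex.real_smul]
  push_cast
  ring

/-- The Fourier transform of an integrable radially symmetric function on ℝ² reduces to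
a one-dimensional integral against the Bessel kernel `J₀(|s|r)`:
`F(s) = 2π ∫₀^∞ J₀(|s|r) f₀(r) r dr`. -/
theorem stmt_2 (f : EuclideanSpace ℝ (Fin 2) → ℂ) (hf : Integrable f)
    (f₀ : ℝ → ℂ) (hrad : ∀ x, f x = f₀ ‖x‖)
    (s : EuclideanSpace ℝ (Fin 2)) :
    ∫ x, Complex.exp (-Complex.I * (⟪s, x⟫ : ℂ)) * f x =
      ((2 * Real.pi : ℝ) : ℂ) *
        ∫ r in Set.Ioi (0 : ℝ),
          ((besselJ 0 (‖s‖ * r) : ℝ) : ℂ) * f₀ r * (r : ℂ) := by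
  let e := Complex.orthonormalBasisOneI.repr
  have hf' : Integrable fun z : ℂ => f₀ ‖z‖ := by
    have h : Integrable fun z => f (e z) := e.measurePreserving.integrable_comp_of_integrable hf
    simpa [hrad] using h
  rw [← e.measurePreserving.integral_comp e.toHomeomorph.measurableEmbedding]
  have key := Complex.integral_exp_inner_mul_radial f₀ hf' (e.symm s)
  rw [e.symm.norm_map] at key
  rw [← key]
  refine integral_congr_ae (.of_forall fun z => ?_)
  simp only [hrad, e.norm_map]
  rw [← e.inner_map_map (e.symm s) z, e.apply_symm_apply]
end

section
/- Let L > 0. For every s ∈ ℝ³ with s ≠ 0, the Fourier transform of the truncated three-dimensional Coulomb (Laplace Green's function) kernel satisfies ∫_{|x|<L} e^{−i⟨s,x⟩} (1/(4π|x|)) dx = 2 (sin(L|s|/2)/|s|)². -/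
open MeasureTheory RealInnerProductSpace

section Slicing

variable {E F : Type*}
  [NormedAddCommGroup E] [InnerProductSpace ℝ E] [FiniteDimensional ℝ E]
  [NormedAddCommGroup F] [InnerProductSpace ℝ F] [FiniteDimensional ℝ F]

lemma exists_linearIsometryEquiv_prod_apply_eq
    (hEF : Module.finrank ℝ E = 1 + Module.finrank ℝ F) (s : E) :
    ∃ φ : E ≃ₗᵢ[ℝ] WithLp 2 (ℝ × F), φ s = WithLp.toLp 2 (‖s‖, 0) := by
  have hrank : Module.finrank ℝ E = Module.finrank ℝ (WithLp 2 (ℝ × F)) := by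
    rw [(WithLp.linearEquiv 2 ℝ (ℝ × F)).finrank_eq, Module.finrank_prod, hEF]
    simp
  let ψ : E ≃ₗᵢ[ℝ] WithLp 2 (ℝ × F) :=
    ((stdOrthonormalBasis ℝ E).reindex (finCongr hrank)).equiv
      (stdOrthonormalBasis ℝ (WithLp 2 (ℝ × F))) (Equiv.refl _)
  have hnorm : ‖ψ s‖ = ‖(WithLp.toLp 2 (‖s‖, (0 : F)) : WithLp 2 (ℝ × F))‖ := by
    rw [ψ.norm_map, WithLp.prod_norm_eq_of_L2]
    simp
  exact ⟨ψ.trans (ℝ ∙ (ψ s - WithLp.toLp 2 (‖s‖, (0 : F))))ᗮ.reflection,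
    Submodule.reflection_sub hnorm⟩

variable [MeasurableSpace E] [BorelSpace E] [MeasurableSpace F] [BorelSpace F]

/-- The Fourier transform of a radial function as the one-dimensional Fourier transform of its
integrals over hyperplanes. -/
lemma integral_cexp_inner_mul_radial
    (hEF : Module.finrank ℝ E = 1 + Module.finrank ℝ F) (s : E) {h : ℝ → ℝ}
    (hint : Integrable fun x : E ↦ h ‖x‖) :
    ∫ x : E, Complex.exp (-Complex.I * (⟪s, x⟫ : ℝ)) * (h ‖x‖ : ℂ) =
      ∫ t : ℝ, Complex.exp (-Complex.I * (‖s‖ * t : ℝ)) *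
        ((∫ y : F, h (√(t ^ 2 + ‖y‖ ^ 2)) : ℝ) : ℂ) := by
  obtain ⟨φ, hφ⟩ := exists_linearIsometryEquiv_prod_apply_eq hEF s
  set f : E → ℂ := fun x ↦ Complex.exp (-Complex.I * (⟪s, x⟫ : ℝ)) * (h ‖x‖ : ℂ) with hf
  have hf_int : Integrable f := by
    refine hint.ofReal.bdd_mul (c := 1) (by fun_prop) (.of_forall fun x ↦ ?_)
    rw [Complex.norm_exp]
    simp
  let e : ℝ × F ≃ᵐ E :=
    (MeasurableEquiv.toLp 2 (ℝ × F)).trans φ.symm.toMeasurableEquiv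
  have he : MeasurePreserving e :=
    φ.symm.measurePreserving.comp (WithLp.volume_preserving_toLp ℝ F)
  have hfe (p : ℝ × F) : f (e p) = Complex.exp (-Complex.I * (‖s‖ * p.1 : ℝ)) *
      (h (√(p.1 ^ 2 + ‖p.2‖ ^ 2)) : ℂ) := by
    have h1 : e p = φ.symm (WithLp.toLp 2 p) := rfl
    have h2 : ⟪s, e p⟫ = ‖s‖ * p.1 := by
      rw [h1, ← φ.inner_map_map, φ.apply_symm_apply, hφ, WithLp.prod_inner_apply]
      simp [mul_comm]
    have h3 : ‖e p‖ = √(p.1 ^ 2 + ‖p.2‖ ^ 2) := by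
      rw [h1, φ.symm.norm_map, WithLp.prod_norm_eq_of_L2]
      simp
    simp only [hf, h2, h3]
  have hfe_int : Integrable (fun p ↦ f (e p)) :=
    (he.integrable_comp_emb e.measurableEmbedding).2 hf_int
  rw [← he.integral_comp e.measurableEmbedding f]
  simp_rw [hfe] at hfe_int ⊢
  rw [Measure.volume_eq_prod] at hfe_int ⊢
  rw [integral_prod _ hfe_int]
  simp_rw [integral_const_mul, integral_complex_ofReal]

end Slicing

/-- The radial profile of the truncated Coulomb kernel in dimension three. -/
noncomputable def truncatedCoulomb (L : ℝ) : ℝ → ℝ :=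
  (Set.Iio L).indicator fun r ↦ 1 / (4 * Real.pi * r)

lemma integrable_truncatedCoulomb_norm (L : ℝ) :
    Integrable fun x : EuclideanSpace ℝ (Fin 3) ↦ truncatedCoulomb L ‖x‖ := by
  rw [integrable_fun_norm_addHaar]
  have hsub : IntegrableOn (fun r : ℝ ↦ r / (4 * Real.pi)) (Set.Ioo 0 L) :=
    (Continuous.integrableOn_Icc (by fun_prop)).mono_set Set.Ioo_subset_Icc_self
  rw [← integrable_indicator_iff measurableSet_Ioo] at hsub
  refine hsub.integrableOn.congr_fun (fun r hr ↦ ?_) measurableSet_Ioi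
  have hr' : (0 : ℝ) < r := hr
  by_cases hrL : r < L
  · simp [truncatedCoulomb, hrL, hr']
    field_simp
  · simp [truncatedCoulomb, hrL]

lemma integral_div_two_mul_sqrt (t : ℝ) {R : ℝ} (hR : 0 ≤ R) :
    ∫ r in 0..R, r / (2 * √(t ^ 2 + r ^ 2)) = (√(t ^ 2 + R ^ 2) - |t|) / 2 := by
  have hcont : Continuous fun r : ℝ ↦ √(t ^ 2 + r ^ 2) / 2 := by fun_prop
  have hderiv (r : ℝ) (hr : 0 < r) :
      HasDerivAt (fun r : ℝ ↦ √(t ^ 2 + r ^ 2) / 2) (r / (2 * √(t ^ 2 + r ^ 2))) r := by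
    have hpos : 0 < t ^ 2 + r ^ 2 := by positivity
    convert! ((((hasDerivAt_id r).pow 2).const_add (t ^ 2)).sqrt hpos.ne').div_const 2 using 1
    simp
    field_simp
  rw [intervalIntegral.integral_eq_sub_of_hasDerivAt_of_le hR hcont.continuousOn
    (fun r hr ↦ hderiv r hr.1)]
  · simp [Real.sqrt_sq_eq_abs]
    ring
  · refine intervalIntegral.intervalIntegrable_deriv_of_nonneg hcont.continuousOn
      (fun r hr ↦ hderiv r ?_) (fun r hr ↦ ?_)
    all_goals
      rw [min_eq_left hR, max_eq_right hR] at hr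
      have := hr.1
    · exact this
    · positivity

lemma integral_truncatedCoulomb_slice {L : ℝ} (hL : 0 < L) (t : ℝ) :
    ∫ y : EuclideanSpace ℝ (Fin 2), truncatedCoulomb L (√(t ^ 2 + ‖y‖ ^ 2)) =
      (Set.Ioc (-L) L).indicator (fun t ↦ (L - |t|) / 2) t := by
  rw [integral_fun_norm_addHaar volume fun r ↦ truncatedCoulomb L (√(t ^ 2 + r ^ 2))]
  have hball : volume.real (Metric.ball (0 : EuclideanSpace ℝ (Fin 2)) 1) = Real.pi := by
    simp [Measure.real, Real.pi_nonneg]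
  have hdim : Module.finrank ℝ (EuclideanSpace ℝ (Fin 2)) = 2 := by simp
  rw [hball, hdim]
  rcases lt_or_ge |t| L with ht | ht
  · set R := √(L ^ 2 - t ^ 2) with hRdef
    have htL : t ^ 2 < L ^ 2 := sq_lt_sq' (abs_lt.1 ht).1 (abs_lt.1 ht).2
    have hR : 0 ≤ R := Real.sqrt_nonneg _
    have hR2 : R ^ 2 = L ^ 2 - t ^ 2 := Real.sq_sqrt (by linarith)
    have hmem : t ∈ Set.Ioc (-L) L := ⟨(abs_lt.1 ht).1, (abs_lt.1 ht).2.le⟩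
    have hset : ∫ r in Set.Ioi (0 : ℝ), r ^ (2 - 1) • truncatedCoulomb L (√(t ^ 2 + r ^ 2)) =
        ∫ r in Set.Ioi (0 : ℝ), (Set.Ioo 0 R).indicator
          (fun r ↦ (1 / (2 * Real.pi)) * (r / (2 * √(t ^ 2 + r ^ 2)))) r := by
      refine setIntegral_congr_fun measurableSet_Ioi fun r hr ↦ ?_
      have hr' : (0 : ℝ) < r := hr
      have hiff : √(t ^ 2 + r ^ 2) < L ↔ r < R := by
        rw [Real.sqrt_lt' hL, hRdef, Real.lt_sqrt hr'.le]
        constructor <;> intro h <;> linarith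
      by_cases hrR : r < R
      · have := hiff.2 hrR
        simp only [truncatedCoulomb, Set.indicator, Set.mem_Iio, Set.mem_Ioo, this, hr', hrR,
          and_self, if_true, smul_eq_mul]
        have : 0 < √(t ^ 2 + r ^ 2) := by positivity
        field_simp
        ring
      · have := mt hiff.1 hrR
        simp [truncatedCoulomb, Set.indicator, this, hrR]
    rw [hset, setIntegral_indicator measurableSet_Ioo,
      Set.inter_eq_right.2 Set.Ioo_subset_Ioi_self, ← integral_Ioc_eq_integral_Ioo,
      ← intervalIntegral.integral_of_le hR, intervalIntegral.integral_const_mul,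
      integral_div_two_mul_sqrt t hR, hR2, Set.indicator_of_mem hmem]
    rw [add_sub_cancel, Real.sqrt_sq hL.le]
    simp
    field_simp
  · have hzero (r : ℝ) : truncatedCoulomb L (√(t ^ 2 + r ^ 2)) = 0 := by
      suffices hle : |t| ≤ √(t ^ 2 + r ^ 2) from
        Set.indicator_of_notMem (s := Set.Iio L) (not_lt.2 (ht.trans hle)) _
      rw [← Real.sqrt_sq_eq_abs]
      exact Real.sqrt_le_sqrt (by nlinarith [sq_nonneg r])
    simp only [hzero, smul_zero, integral_zero]
    symm
    rw [Set.indicator_apply_eq_zero]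
    intro hmem
    have : |t| ≤ L := abs_le.2 ⟨hmem.1.le, hmem.2⟩
    linarith

lemma integral_sub_mul_cos {κ : ℝ} (hκ : κ ≠ 0) (L : ℝ) :
    ∫ t in 0..L, (L - t) * Real.cos (κ * t) = (1 - Real.cos (κ * L)) / κ ^ 2 := by
  have hderiv (t : ℝ) : HasDerivAt
      (fun t ↦ (L - t) * (Real.sin (κ * t) / κ) - Real.cos (κ * t) / κ ^ 2)
      ((L - t) * Real.cos (κ * t)) t := by
    have hlin : HasDerivAt (fun t ↦ κ * t) κ t := by simpa using (hasDerivAt_id t).const_mul κ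
    convert! (((hasDerivAt_id t).const_sub L).mul (hlin.sin.div_const κ)).sub
      (hlin.cos.div_const (κ ^ 2)) using 1
    simp
    field_simp
    ring
  rw [intervalIntegral.integral_eq_sub_of_hasDerivAt (fun t _ ↦ hderiv t)
    (Continuous.intervalIntegrable (by fun_prop) _ _)]
  simp
  ring

/-- The Fourier transform of the triangle function. -/
lemma integral_cexp_mul_triangle {κ L : ℝ} (hκ : κ ≠ 0) (hL : 0 ≤ L) :
    ∫ t in (-L)..L, Complex.exp (-Complex.I * (κ * t : ℝ)) * (((L - |t|) / 2 : ℝ) : ℂ) =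
      (((1 - Real.cos (κ * L)) / κ ^ 2 : ℝ) : ℂ) := by
  set f : ℝ → ℂ := fun t ↦
    Complex.exp (-Complex.I * (κ * t : ℝ)) * (((L - |t|) / 2 : ℝ) : ℂ) with hf
  have hcont : Continuous f := by fun_prop
  have hneg : ∫ t in (-L)..0, f t = ∫ t in 0..L, f (-t) := by
    simp [intervalIntegral.integral_comp_neg]
  rw [← intervalIntegral.integral_add_adjacent_intervals (hcont.intervalIntegrable (-L) 0)
    (hcont.intervalIntegrable 0 L), hneg, ← intervalIntegral.integral_add
    (Continuous.intervalIntegrable (u := fun t ↦ f (-t)) (hcont.comp continuous_neg) 0 L)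
    (hcont.intervalIntegrable 0 L),
    ← integral_sub_mul_cos hκ, ← intervalIntegral.integral_ofReal]
  refine intervalIntegral.integral_congr fun t ht ↦ ?_
  rw [Set.uIcc_of_le hL] at ht
  simp only [hf, abs_neg, abs_of_nonneg ht.1]
  push_cast
  rw [Complex.cos, show -Complex.I * (κ * -t) = κ * t * Complex.I by ring,
    show -Complex.I * (κ * t) = -(κ * t) * Complex.I by ring]
  ring

/-- The Fourier transform of the truncated 3D Coulomb kernel `1/(4π|x|)·1_{|x|<L}`
is `2 (sin(L|s|/2)/|s|)²`. -/
theorem stmt_3 (L : ℝ) (hL : 0 < L)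
    (s : EuclideanSpace ℝ (Fin 3)) (hs : s ≠ 0) :
    ∫ x in Metric.ball (0 : EuclideanSpace ℝ (Fin 3)) L,
        Complex.exp (-Complex.I * (⟪s, x⟫ : ℂ)) * ((1 / (4 * Real.pi * ‖x‖) : ℝ) : ℂ) =
      ((2 * (Real.sin (L * ‖s‖ / 2) / ‖s‖) ^ 2 : ℝ) : ℂ) := by
  have hs' : ‖s‖ ≠ 0 := norm_ne_zero_iff.2 hs
  have hball : ∫ x in Metric.ball (0 : EuclideanSpace ℝ (Fin 3)) L,
        Complex.exp (-Complex.I * (⟪s, x⟫ : ℂ)) * ((1 / (4 * Real.pi * ‖x‖) : ℝ) : ℂ) =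
      ∫ x : EuclideanSpace ℝ (Fin 3),
        Complex.exp (-Complex.I * (⟪s, x⟫ : ℝ)) * (truncatedCoulomb L ‖x‖ : ℂ) := by
    rw [← integral_indicator measurableSet_ball]
    congr 1 with x
    by_cases hx : ‖x‖ < L <;> simp [truncatedCoulomb, Set.indicator, hx]
  rw [hball, integral_cexp_inner_mul_radial (F := EuclideanSpace ℝ (Fin 2)) (by simp) s
    (integrable_truncatedCoulomb_norm L)]
  simp_rw [integral_truncatedCoulomb_slice hL]
  have hind (t : ℝ) : Complex.exp (-Complex.I * (‖s‖ * t : ℝ)) *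
      (((Set.Ioc (-L) L).indicator (fun t ↦ (L - |t|) / 2) t : ℝ) : ℂ) =
      (Set.Ioc (-L) L).indicator (fun t : ℝ ↦ Complex.exp (-Complex.I * (‖s‖ * t : ℝ)) *
        (((L - |t|) / 2 : ℝ) : ℂ)) t := by
    by_cases ht : t ∈ Set.Ioc (-L) L
    · simp only [Set.indicator_of_mem ht]
    · simp only [Set.indicator_of_notMem ht, Complex.ofReal_zero, mul_zero]
  simp_rw [hind]
  rw [integral_indicator measurableSet_Ioc, ← intervalIntegral.integral_of_le (by linarith),
    integral_cexp_mul_triangle hs' hL.le]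
  congr 1
  rw [show ‖s‖ * L = 2 * (L * ‖s‖ / 2) by ring, Real.cos_two_mul, Real.cos_sq']
  ring
end

section
/- Let L > 0 and k > 0. For every s ∈ ℝ³ with |s| ≠ 0 and |s| ≠ k, the Fourier transform of the truncated three-dimensional Helmholtz Green's function satisfies ∫_{|x|<L} e^{−i⟨s,x⟩} (e^{ik|x|}/(4π|x|)) dx = (−1 + e^{iLk}(cos(L|s|) − i (k/|s|) sin(L|s|))) / ((k − |s|)(k + |s|)). -/
open MeasureTheory RealInnerProductSpace

/-- Cylindrical coordinates adapted to a vector `s`: the first coordinate is the component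
along `s`. -/
lemma exists_linearIsometryEquiv_inner_eq (s : EuclideanSpace ℝ (Fin 3)) :
    ∃ Φ : WithLp 2 (ℝ × EuclideanSpace ℝ (Fin 2)) ≃ₗᵢ[ℝ] EuclideanSpace ℝ (Fin 3),
      ∀ p, ⟪s, Φ p⟫ = ‖s‖ * p.fst := by
  have hdim : Module.finrank ℝ (WithLp 2 (ℝ × EuclideanSpace ℝ (Fin 2))) =
      Module.finrank ℝ (EuclideanSpace ℝ (Fin 3)) := by
    rw [(WithLp.linearEquiv 2 ℝ (ℝ × EuclideanSpace ℝ (Fin 2))).finrank_eq]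
    simp
  let e := (stdOrthonormalBasis ℝ (WithLp 2 (ℝ × EuclideanSpace ℝ (Fin 2)))).equiv
    (stdOrthonormalBasis ℝ (EuclideanSpace ℝ (Fin 3))) (finCongr hdim)
  let w : WithLp 2 (ℝ × EuclideanSpace ℝ (Fin 2)) := WithLp.toLp 2 (‖s‖, 0)
  have hw : ‖e.symm s‖ = ‖w‖ := by
    simp [w]
  let R := (ℝ ∙ (e.symm s - w))ᗮ.reflection
  have hR : R (e.symm s) = w := Submodule.reflection_sub hw
  refine ⟨(e.symm.trans R).symm, fun p => ?_⟩
  rw [← (e.symm.trans R).inner_map_map]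
  simp only [LinearIsometryEquiv.apply_symm_apply, LinearIsometryEquiv.trans_apply, hR]
  simp [w, WithLp.prod_inner_apply, mul_comm]

/-- Integration in cylindrical coordinates of a plane wave times a radial function. -/
lemma integral_exp_inner_mul_radial (s : EuclideanSpace ℝ (Fin 3)) (h : ℝ → ℂ)
    (hh : Integrable (fun x : EuclideanSpace ℝ (Fin 3) => h ‖x‖)) :
    ∫ x : EuclideanSpace ℝ (Fin 3), Complex.exp (-Complex.I * (⟪s, x⟫ : ℂ)) * h ‖x‖ =
      ∫ z : ℝ, Complex.exp (-Complex.I * ((‖s‖ * z : ℝ) : ℂ)) *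
        (2 * Real.pi * ∫ ρ in Set.Ioi (0 : ℝ), (ρ : ℂ) * h √(z ^ 2 + ρ ^ 2)) := by
  obtain ⟨Φ, hΦ⟩ := exists_linearIsometryEquiv_inner_eq s
  have hmp := Φ.measurePreserving.comp
    (WithLp.volume_preserving_toLp ℝ (EuclideanSpace ℝ (Fin 2)))
  have hemb : MeasurableEmbedding (Φ ∘ WithLp.toLp 2) :=
    Φ.toHomeomorph.measurableEmbedding.comp
      (MeasurableEquiv.toLp 2 (ℝ × EuclideanSpace ℝ (Fin 2))).measurableEmbedding
  have hint : Integrable (fun x : EuclideanSpace ℝ (Fin 3) =>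
      Complex.exp (-Complex.I * (⟪s, x⟫ : ℂ)) * h ‖x‖) := by
    refine hh.bdd_mul (c := 1) (Continuous.aestronglyMeasurable (by fun_prop)) ?_
    refine Filter.Eventually.of_forall fun x => ?_
    simp [Complex.norm_exp]
  rw [← hmp.integral_comp hemb]
  have hint' := (hmp.integrable_comp_emb hemb).2 hint
  rw [Measure.volume_eq_prod, integral_prod _ (by exact hint')]
  refine integral_congr_ae (Filter.Eventually.of_forall fun z => ?_)
  simp only [Function.comp_apply, hΦ, LinearIsometryEquiv.norm_map, WithLp.prod_norm_eq_of_L2,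
    Real.norm_eq_abs, sq_abs, WithLp.toLp_fst, WithLp.toLp_snd]
  rw [integral_const_mul,
    integral_fun_norm_addHaar volume (fun ρ : ℝ => h √(z ^ 2 + ρ ^ 2))]
  simp [Measure.real, Real.pi_pos.le]
  ring

/-- The radial integral of the Helmholtz kernel over a disc at height `z ≠ 0`. -/
lemma integral_mul_exp_sqrt {k z L : ℝ} (hk : k ≠ 0) (hz : z ≠ 0) (hzL : |z| < L) :
    ∫ ρ in (0 : ℝ)..√(L ^ 2 - z ^ 2), (ρ : ℂ) *
        (Complex.exp (Complex.I * k * (√(z ^ 2 + ρ ^ 2) : ℝ)) /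
          ((4 * Real.pi * √(z ^ 2 + ρ ^ 2) : ℝ) : ℂ)) =
      (Complex.exp (Complex.I * L * k) - Complex.exp (Complex.I * k * (|z| : ℝ))) /
        (4 * Real.pi * Complex.I * k) := by
  have hkC : (k : ℂ) ≠ 0 := by exact_mod_cast hk
  have hpi : (Real.pi : ℂ) ≠ 0 := by exact_mod_cast Real.pi_ne_zero
  have hpos : ∀ ρ : ℝ, 0 < z ^ 2 + ρ ^ 2 := fun ρ => by positivity
  have hne : ∀ ρ : ℝ, (√(z ^ 2 + ρ ^ 2) : ℂ) ≠ 0 := fun ρ => by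
    exact_mod_cast (Real.sqrt_pos.2 (hpos ρ)).ne'
  have hd : ∀ ρ : ℝ, HasDerivAt
      (fun ρ : ℝ => Complex.exp (Complex.I * k * (√(z ^ 2 + ρ ^ 2) : ℝ)) /
        (4 * Real.pi * Complex.I * k))
      ((ρ : ℂ) * (Complex.exp (Complex.I * k * (√(z ^ 2 + ρ ^ 2) : ℝ)) /
          ((4 * Real.pi * √(z ^ 2 + ρ ^ 2) : ℝ) : ℂ))) ρ := by
    intro ρ
    have h1 : HasDerivAt (fun ρ : ℝ => √(z ^ 2 + ρ ^ 2)) (ρ / √(z ^ 2 + ρ ^ 2)) ρ := by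
      have := (((hasDerivAt_id ρ).pow 2).const_add (z ^ 2)).sqrt (hpos ρ).ne'
      refine this.congr_deriv ?_
      have := (Real.sqrt_pos.2 (hpos ρ)).ne'
      simp
      field_simp
    have h2 := ((h1.ofReal_comp.const_mul (Complex.I * k)).cexp).div_const
      (4 * Real.pi * Complex.I * k)
    refine h2.congr_deriv ?_
    have := hne ρ
    push_cast
    field_simp
  rw [intervalIntegral.integral_eq_sub_of_hasDerivAt (fun ρ _ => hd ρ)]
  · have hL : 0 < L := (abs_nonneg z).trans_lt hzL
    have h1 : z ^ 2 ≤ L ^ 2 := sq_le_sq.2 (by rw [abs_of_pos hL]; exact hzL.le)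
    rw [Real.sq_sqrt (by linarith), add_sub_cancel, Real.sqrt_sq hL.le]
    simp only [ne_eq, OfNat.ofNat_ne_zero, not_false_eq_true, zero_pow, add_zero,
      Real.sqrt_sq_eq_abs]
    rw [← sub_div]
    ring_nf
  · apply Continuous.intervalIntegrable
    refine Complex.continuous_ofReal.mul (Continuous.div (by fun_prop) (by fun_prop) fun ρ => ?_)
    push_cast
    exact mul_ne_zero (by simp [hpi]) (hne ρ)

/-- The radial integral, over the whole plane at height `z`, of the truncated Helmholtz kernel. -/
lemma setIntegral_Ioi_mul_truncated_exp_sqrt {k z L : ℝ} (hk : k ≠ 0) (hz : z ≠ 0) (hL : 0 < L) :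
    ∫ ρ in Set.Ioi (0 : ℝ), (ρ : ℂ) * (Set.Iio L).indicator
        (fun r : ℝ => Complex.exp (Complex.I * k * (r : ℂ)) / ((4 * Real.pi * r : ℝ) : ℂ))
        √(z ^ 2 + ρ ^ 2) =
      (Set.Ioo (-L) L).indicator (fun z : ℝ =>
        (Complex.exp (Complex.I * L * k) - Complex.exp (Complex.I * k * (|z| : ℝ))) /
          (4 * Real.pi * Complex.I * k)) z := by
  by_cases hzL : |z| < L
  · rw [Set.indicator_of_mem (by exact abs_lt.1 hzL), ← integral_mul_exp_sqrt hk hz hzL,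
      intervalIntegral.integral_of_le (Real.sqrt_nonneg _), integral_Ioc_eq_integral_Ioo,
      ← Set.Ioi_inter_Iio, ← setIntegral_indicator measurableSet_Iio]
    refine setIntegral_congr_fun measurableSet_Ioi fun ρ hρ => ?_
    have hρ : 0 < ρ := hρ
    have : √(z ^ 2 + ρ ^ 2) < L ↔ ρ < √(L ^ 2 - z ^ 2) := by
      rw [Real.sqrt_lt' hL, Real.lt_sqrt hρ.le, lt_sub_iff_add_lt']
    by_cases h : ρ < √(L ^ 2 - z ^ 2) <;> simp [Set.indicator, this, h]
  · rw [Set.indicator_of_notMem (by rw [Set.mem_Ioo, ← abs_lt]; exact hzL)]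
    refine setIntegral_eq_zero_of_forall_eq_zero fun ρ _ => ?_
    rw [Set.indicator_of_notMem, mul_zero]
    rw [Set.mem_Iio, not_lt]
    refine (not_lt.1 hzL).trans (Real.abs_le_sqrt ?_)
    nlinarith [sq_nonneg ρ]

lemma integral_exp_mul_const_sub_exp {σ k L : ℝ} (C : ℂ) (hσ : σ ≠ 0) (hσk : σ ≠ k) :
    ∫ z in (0 : ℝ)..L, Complex.exp (-Complex.I * ((σ * z : ℝ) : ℂ)) *
        (C - Complex.exp (Complex.I * k * z)) =
      C * (Complex.exp (-Complex.I * L * σ) - 1) / (-Complex.I * σ) -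
        (Complex.exp (Complex.I * L * k) * Complex.exp (-Complex.I * L * σ) - 1) /
          (Complex.I * (k - σ)) := by
  have h1 : (-Complex.I * σ : ℂ) ≠ 0 := by simp [hσ]
  have h2 : (Complex.I * (k - σ) : ℂ) ≠ 0 := by
    refine mul_ne_zero Complex.I_ne_zero (sub_ne_zero.2 ?_)
    exact_mod_cast hσk.symm
  have : ∀ z : ℝ, Complex.exp (-Complex.I * ((σ * z : ℝ) : ℂ)) *
        (C - Complex.exp (Complex.I * k * z)) =
      C * Complex.exp (-Complex.I * σ * z) - Complex.exp (Complex.I * (k - σ) * z) := by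
    intro z
    rw [mul_sub, ← Complex.exp_add]
    push_cast
    ring_nf
  simp_rw [this]
  rw [intervalIntegral.integral_sub (Continuous.intervalIntegrable (by fun_prop) _ _)
    (Continuous.intervalIntegrable (by fun_prop) _ _), intervalIntegral.integral_const_mul,
    integral_exp_mul_complex h1, integral_exp_mul_complex h2, ← Complex.exp_add]
  simp only [Complex.ofReal_zero, mul_zero, Complex.exp_zero]
  ring_nf

/-- The Fourier transform of the truncated 3D Helmholtz kernel
`(e^{ik|x|}/(4π|x|))·1_{|x|<L}` is
`(−1 + e^{iLk}(cos(L|s|) − i(k/|s|) sin(L|s|)))/((k−|s|)(k+|s|))`. -/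
theorem stmt_4 (L k : ℝ) (hL : 0 < L) (hk : 0 < k)
    (s : EuclideanSpace ℝ (Fin 3)) (hs0 : ‖s‖ ≠ 0) (hsk : ‖s‖ ≠ k) :
    ∫ x in Metric.ball (0 : EuclideanSpace ℝ (Fin 3)) L,
        Complex.exp (-Complex.I * (⟪s, x⟫ : ℂ)) *
          (Complex.exp (Complex.I * (k : ℂ) * (‖x‖ : ℂ)) / ((4 * Real.pi * ‖x‖ : ℝ) : ℂ)) =
      (-1 + Complex.exp (Complex.I * (L : ℂ) * (k : ℂ)) *
          ((Real.cos (L * ‖s‖) : ℂ) -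
            Complex.I * ((k / ‖s‖ : ℝ) : ℂ) * (Real.sin (L * ‖s‖) : ℂ))) /
        (((k - ‖s‖) * (k + ‖s‖) : ℝ) : ℂ) := by
  set g : ℝ → ℂ := fun r =>
    Complex.exp (Complex.I * k * (r : ℂ)) / ((4 * Real.pi * r : ℝ) : ℂ) with hg
  set C : ℂ := Complex.exp (Complex.I * L * k) with hC
  have hint : Integrable (fun x : EuclideanSpace ℝ (Fin 3) => (Set.Iio L).indicator g ‖x‖) := by
    have hball : IntegrableOn (fun x : EuclideanSpace ℝ (Fin 3) => g ‖x‖) (Metric.ball 0 L) := by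
      rw [integrableOn_fun_norm_addHaar]
      have hcont : Continuous fun y : ℝ =>
          (y : ℂ) * Complex.exp (Complex.I * k * (y : ℂ)) / (4 * Real.pi) := by fun_prop
      refine ((hcont.integrableOn_Icc (a := 0) (b := L)).mono_set Set.Ioo_subset_Icc_self).congr_fun
        (fun y hy => ?_) measurableSet_Ioo
      have hy0 : (y : ℂ) ≠ 0 := by exact_mod_cast hy.1.ne'
      have hpi : (Real.pi : ℂ) ≠ 0 := by exact_mod_cast Real.pi_ne_zero
      simp [hg]
      field_simp
    rw [← integrable_indicator_iff Metric.isOpen_ball.measurableSet] at hball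
    refine hball.congr (Filter.Eventually.of_forall fun x => ?_)
    simp [Set.indicator]
  have hstart : ∫ x in Metric.ball (0 : EuclideanSpace ℝ (Fin 3)) L,
        Complex.exp (-Complex.I * (⟪s, x⟫ : ℂ)) * g ‖x‖ =
      ∫ x : EuclideanSpace ℝ (Fin 3), Complex.exp (-Complex.I * (⟪s, x⟫ : ℂ)) *
        (Set.Iio L).indicator g ‖x‖ := by
    rw [← integral_indicator Metric.isOpen_ball.measurableSet]
    congr 1 with x
    simp [Set.indicator]
  have hslice : ∫ z : ℝ, Complex.exp (-Complex.I * ((‖s‖ * z : ℝ) : ℂ)) *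
        (2 * Real.pi * ∫ ρ in Set.Ioi (0 : ℝ), (ρ : ℂ) *
          (Set.Iio L).indicator g √(z ^ 2 + ρ ^ 2)) =
      (∫ z in (-L)..L, Complex.exp (-Complex.I * ((‖s‖ * z : ℝ) : ℂ)) *
        (C - Complex.exp (Complex.I * k * (|z| : ℝ)))) / (2 * Complex.I * k) := by
    rw [intervalIntegral.integral_of_le (by linarith), integral_Ioc_eq_integral_Ioo,
      ← integral_indicator measurableSet_Ioo, ← integral_div]
    refine integral_congr_ae ?_
    filter_upwards [compl_mem_ae_iff.2 (measure_singleton (0 : ℝ))] with z hz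
    rw [setIntegral_Ioi_mul_truncated_exp_sqrt hk.ne' hz hL]
    have hpi : (Real.pi : ℂ) ≠ 0 := by exact_mod_cast Real.pi_ne_zero
    have hkC : (k : ℂ) ≠ 0 := by exact_mod_cast hk.ne'
    by_cases h : z ∈ Set.Ioo (-L) L
    · simp only [Set.indicator_of_mem h]
      field_simp
      norm_num [hC]
    · simp only [Set.indicator_of_notMem h]
      simp
  have hcont : Continuous fun z : ℝ => Complex.exp (-Complex.I * ((‖s‖ * z : ℝ) : ℂ)) *
        (C - Complex.exp (Complex.I * k * (|z| : ℝ))) := by fun_prop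
  have hright : ∫ z in (0 : ℝ)..L, Complex.exp (-Complex.I * ((‖s‖ * z : ℝ) : ℂ)) *
        (C - Complex.exp (Complex.I * k * (|z| : ℝ))) =
      ∫ z in (0 : ℝ)..L, Complex.exp (-Complex.I * ((‖s‖ * z : ℝ) : ℂ)) *
        (C - Complex.exp (Complex.I * k * z)) := by
    refine intervalIntegral.integral_congr fun z hz => ?_
    rw [Set.uIcc_of_le hL.le] at hz
    simp only [abs_of_nonneg hz.1]
  have hleft : ∫ z in (-L)..0, Complex.exp (-Complex.I * ((‖s‖ * z : ℝ) : ℂ)) *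
        (C - Complex.exp (Complex.I * k * (|z| : ℝ))) =
      ∫ z in (0 : ℝ)..L, Complex.exp (-Complex.I * ((-‖s‖ * z : ℝ) : ℂ)) *
        (C - Complex.exp (Complex.I * k * z)) := by
    rw [← neg_zero, ← intervalIntegral.integral_comp_neg, neg_zero]
    refine intervalIntegral.integral_congr fun z hz => ?_
    rw [Set.uIcc_of_le hL.le] at hz
    simp only [abs_neg, abs_of_nonneg hz.1, mul_neg, neg_mul]
  have hsk' : -‖s‖ ≠ k := by linarith [norm_nonneg s]
  rw [hstart, integral_exp_inner_mul_radial s _ hint, hslice,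
    ← intervalIntegral.integral_add_adjacent_intervals (hcont.intervalIntegrable _ 0)
      (hcont.intervalIntegrable 0 _), hleft, hright,
    integral_exp_mul_const_sub_exp C hs0 hsk,
    integral_exp_mul_const_sub_exp C (neg_ne_zero.2 hs0) hsk', ← hC]
  generalize ‖s‖ = σ at *
  have e1 : Complex.exp (-Complex.I * L * σ) =
      Complex.cos (L * σ) - Complex.sin (L * σ) * Complex.I := by
    have h := Complex.exp_mul_I (-(L * σ))
    rw [Complex.cos_neg, Complex.sin_neg] at h
    convert h using 1 <;> ring_nf
  have e2 : Complex.exp (-Complex.I * L * (-σ : ℝ)) =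
      Complex.cos (L * σ) + Complex.sin (L * σ) * Complex.I := by
    rw [← Complex.exp_mul_I]; push_cast; ring_nf
  rw [e1, e2]
  have n1 : (k : ℂ) ≠ 0 := by exact_mod_cast hk.ne'
  have n2 : (σ : ℂ) ≠ 0 := by exact_mod_cast hs0
  have n3 : (k : ℂ) - σ ≠ 0 := sub_ne_zero.2 (by exact_mod_cast hsk.symm)
  have n4 : (k : ℂ) + σ ≠ 0 := by
    rw [← sub_neg_eq_add]; exact sub_ne_zero.2 (by exact_mod_cast hsk'.symm)
  have n5 := Complex.I_ne_zero
  push_cast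
  generalize Complex.cos (L * σ) = c
  generalize Complex.sin (L * σ) = d
  rw [sub_neg_eq_add]
  field_simp
  ring_nf
  simp only [Complex.I_sq, show Complex.I ^ 3 = -Complex.I by rw [pow_succ, Complex.I_sq]; ring]
  ring
end

section
/- Let L > 0. For every s ∈ ℝ³ with s ≠ 0, writing σ = |s|, the Fourier transform of the truncated three-dimensional biharmonic Green's function satisfies ∫_{|x|<L} e^{−i⟨s,x⟩} (|x|/(8π)) dx = ((2 − L²σ²) cos(Lσ) + 2Lσ sin(Lσ) − 2) / (2σ⁴). -/
open MeasureTheory RealInnerProductSpace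

/-- A volume-preserving splitting of `ℝ³` into the axis spanned by `s` and its orthogonal plane. -/
theorem exists_measurableEquiv_prod_axis (s : EuclideanSpace ℝ (Fin 3)) (hs : s ≠ 0) :
    ∃ e : EuclideanSpace ℝ (Fin 3) ≃ᵐ ℝ × EuclideanSpace ℝ (Fin 2),
      MeasurePreserving e ∧ (∀ x, ⟪s, x⟫ = ‖s‖ * (e x).1) ∧
        ∀ x, ‖x‖ = √((e x).1 ^ 2 + ‖(e x).2‖ ^ 2) := by
  have hs' : ‖s‖ ≠ 0 := norm_ne_zero_iff.2 hs
  obtain ⟨b, hb⟩ := Orthonormal.exists_orthonormalBasis_extension_of_card_eq (𝕜 := ℝ)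
    (E := EuclideanSpace ℝ (Fin 3)) (ι := Fin 3) (by simp)
    (v := fun _ => ‖s‖⁻¹ • s) (s := {0}) (by
      constructor
      · intro i
        simp [norm_smul, hs']
      · intro i j hij
        exact absurd (Subsingleton.elim i j) hij)
  have hb0 : b 0 = ‖s‖⁻¹ • s := hb 0 rfl
  refine ⟨(b.measurableEquiv.trans (MeasurableEquiv.toLp 2 (Fin 3 → ℝ)).symm).trans
    ((MeasurableEquiv.piFinSuccAbove (fun _ => ℝ) 0).trans
      (MeasurableEquiv.prodCongr (MeasurableEquiv.refl ℝ) (MeasurableEquiv.toLp 2 (Fin 2 → ℝ)))),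
    ?_, fun x => ?_, fun x => ?_⟩
  · exact (b.measurePreserving_measurableEquiv.trans
      (EuclideanSpace.volume_preserving_symm_measurableEquiv_toLp _)).trans
      ((volume_preserving_piFinSuccAbove (fun _ : Fin 3 => ℝ) 0).trans
        ((MeasurePreserving.id volume).prod (PiLp.volume_preserving_toLp (Fin 2))))
  · change ⟪s, x⟫ = ‖s‖ * b.repr x 0
    rw [b.repr_apply_apply, hb0, real_inner_smul_left, mul_inv_cancel_left₀ hs']
  · change ‖x‖ = √((b.repr x 0) ^ 2 +
      ‖WithLp.toLp 2 (fun i : Fin 2 => b.repr x i.succ)‖ ^ 2)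
    rw [← b.repr.norm_map x, EuclideanSpace.norm_eq, EuclideanSpace.norm_sq_eq]
    congr 1
    simp [Fin.sum_univ_succ]

theorem integral_mul_sqrt_sq_add_sq {z R : ℝ} (hR : 0 ≤ R) :
    ∫ y in (0 : ℝ)..R, y * √(z ^ 2 + y ^ 2) = (√(z ^ 2 + R ^ 2) ^ 3 - |z| ^ 3) / 3 := by
  rw [intervalIntegral.integral_eq_sub_of_hasDerivAt_of_le
    (f := fun y => √(z ^ 2 + y ^ 2) ^ 3 / 3) hR (by fun_prop)]
  · simp only [ne_eq, OfNat.ofNat_ne_zero, not_false_eq_true, zero_pow, add_zero, Real.sqrt_sq_eq_abs]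
    ring
  · intro y hy
    have hpos : 0 < z ^ 2 + y ^ 2 := by have := hy.1; positivity
    have hd : HasDerivAt (fun y : ℝ => z ^ 2 + y ^ 2) (2 * y) y := by
      simpa using (hasDerivAt_pow 2 y).const_add (z ^ 2)
    convert! ((hd.sqrt hpos.ne').pow 3).div_const 3 using 1
    have := (Real.sqrt_pos.2 hpos).ne'
    push_cast
    field_simp
  · exact Continuous.intervalIntegrable (by fun_prop) _ _

/-- The integral over a horizontal slice of the ball of radius `L` of the norm. -/
theorem integral_slice_norm {L : ℝ} (hL : 0 < L) (z : ℝ) :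
    ∫ w : EuclideanSpace ℝ (Fin 2),
        (if √(z ^ 2 + ‖w‖ ^ 2) < L then √(z ^ 2 + ‖w‖ ^ 2) else 0) =
      if |z| < L then 2 * Real.pi * ((L ^ 3 - |z| ^ 3) / 3) else 0 := by
  rw [integral_fun_norm_addHaar volume
    (fun r : ℝ => if √(z ^ 2 + r ^ 2) < L then √(z ^ 2 + r ^ 2) else 0)]
  have hlt (y : ℝ) : √(z ^ 2 + y ^ 2) < L ↔ z ^ 2 + y ^ 2 < L ^ 2 := Real.sqrt_lt' hL
  have hvol : volume.real (Metric.ball (0 : EuclideanSpace ℝ (Fin 2)) 1) = Real.pi := by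
    simp [Measure.real, Real.pi_pos.le]
  rw [hvol]
  simp only [finrank_euclideanSpace, Fintype.card_fin, Nat.add_one_sub_one, pow_one, smul_eq_mul,
    nsmul_eq_mul, Nat.cast_ofNat]
  split_ifs with hz
  · have hz2 : z ^ 2 < L ^ 2 := sq_lt_sq' (neg_lt_of_abs_lt hz) (lt_of_abs_lt hz)
    have hR : 0 ≤ √(L ^ 2 - z ^ 2) := Real.sqrt_nonneg _
    have hRs : √(L ^ 2 - z ^ 2) ^ 2 = L ^ 2 - z ^ 2 := Real.sq_sqrt (by linarith)
    have h := integral_mul_sqrt_sq_add_sq (z := z) hR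
    rw [hRs, add_sub_cancel, Real.sqrt_sq hL.le, intervalIntegral.integral_of_le hR,
      integral_Ioc_eq_integral_Ioo] at h
    rw [← h, mul_assoc, ← integral_indicator measurableSet_Ioo,
      ← integral_indicator measurableSet_Ioi]
    congr 3
    ext y
    by_cases hy : 0 < y
    · have : y < √(L ^ 2 - z ^ 2) ↔ √(z ^ 2 + y ^ 2) < L := by
        rw [hlt, Real.lt_sqrt hy.le]
        constructor <;> intro h <;> linarith
      by_cases hy' : √(z ^ 2 + y ^ 2) < L <;> simp [Set.indicator, hy, hy', this]
    · simp [Set.indicator, hy]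
  · have hz2 : L ^ 2 ≤ z ^ 2 := by
      rw [← sq_abs z]; exact pow_le_pow_left₀ hL.le (not_lt.1 hz) 2
    have (y : ℝ) : ¬ √(z ^ 2 + y ^ 2) < L := by
      rw [hlt]; nlinarith [sq_nonneg y]
    simp [this]

theorem integral_cos_mul_cube_sub {L k : ℝ} (hk : k ≠ 0) :
    ∫ z in (0 : ℝ)..L, 2 * Real.cos (k * z) * ((L ^ 3 - z ^ 3) / 12) =
      ((2 - L ^ 2 * k ^ 2) * Real.cos (L * k) + 2 * L * k * Real.sin (L * k) - 2) /
          (2 * k ^ 4) := by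
  rw [intervalIntegral.integral_eq_sub_of_hasDerivAt
    (f := fun z => Real.sin (k * z) * (L ^ 3 - z ^ 3) / (6 * k) +
      (2 * k * (z * Real.sin (k * z)) + 2 * Real.cos (k * z) - k ^ 2 * (z ^ 2 * Real.cos (k * z))) /
        (2 * k ^ 4))]
  · rw [mul_comm k L]
    simp only [mul_zero, Real.sin_zero, Real.cos_zero]
    field_simp
    ring
  · intro z _
    have hl : HasDerivAt (fun z : ℝ => k * z) k z := by
      simpa using (hasDerivAt_id z).const_mul k
    convert! ((hl.sin.mul ((hasDerivAt_pow 3 z).const_sub (L ^ 3))).div_const (6 * k)).add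
      ((((((hasDerivAt_id z).mul hl.sin).const_mul (2 * k)).add (hl.cos.const_mul 2)).sub
        (((hasDerivAt_pow 2 z).mul hl.cos).const_mul (k ^ 2))).div_const (2 * k ^ 4)) using 1
    simp only [id]
    push_cast
    field_simp
    ring
  · exact Continuous.intervalIntegrable (by fun_prop) _ _

theorem integral_exp_mul_cube_sub {L k : ℝ} (hL : 0 < L) (hk : k ≠ 0) :
    ∫ z in (-L)..L, Complex.exp (-Complex.I * ((k * z : ℝ) : ℂ)) *
        (((L ^ 3 - |z| ^ 3) / 12 : ℝ) : ℂ) =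
      ((((2 - L ^ 2 * k ^ 2) * Real.cos (L * k) + 2 * L * k * Real.sin (L * k) - 2) /
          (2 * k ^ 4) : ℝ) : ℂ) := by
  have hc : Continuous fun z : ℝ => Complex.exp (-Complex.I * ((k * z : ℝ) : ℂ)) *
        (((L ^ 3 - |z| ^ 3) / 12 : ℝ) : ℂ) := by fun_prop
  have hneg := intervalIntegral.integral_comp_neg (a := 0) (b := L)
    fun z : ℝ => Complex.exp (-Complex.I * ((k * z : ℝ) : ℂ)) *
        (((L ^ 3 - |z| ^ 3) / 12 : ℝ) : ℂ)
  rw [neg_zero] at hneg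
  rw [← intervalIntegral.integral_add_adjacent_intervals (hc.intervalIntegrable (-L) 0)
    (hc.intervalIntegrable 0 L), ← hneg, ← intervalIntegral.integral_add
      (Continuous.intervalIntegrable (by fun_prop) _ _) (hc.intervalIntegrable 0 L),
    ← integral_cos_mul_cube_sub hk, ← intervalIntegral.integral_ofReal]
  refine intervalIntegral.integral_congr fun z hz => ?_
  rw [Set.uIcc_of_le hL.le] at hz
  simp only [abs_neg, abs_of_nonneg hz.1, mul_neg]
  push_cast
  rw [Complex.two_cos, ← add_mul]
  congr 1
  ring_nf

/-- The Fourier transform of the truncated 3D biharmonic kernel `(|x|/(8π))·1_{|x|<L}`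
is `((2 − L²σ²)cos(Lσ) + 2Lσ sin(Lσ) − 2)/(2σ⁴)`, with `σ = |s|`. -/
theorem stmt_5 (L : ℝ) (hL : 0 < L)
    (s : EuclideanSpace ℝ (Fin 3)) (hs : s ≠ 0) :
    ∫ x in Metric.ball (0 : EuclideanSpace ℝ (Fin 3)) L,
        Complex.exp (-Complex.I * (⟪s, x⟫ : ℂ)) * ((‖x‖ / (8 * Real.pi) : ℝ) : ℂ) =
      ((((2 - L ^ 2 * ‖s‖ ^ 2) * Real.cos (L * ‖s‖) + 2 * L * ‖s‖ * Real.sin (L * ‖s‖) - 2) /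
          (2 * ‖s‖ ^ 4) : ℝ) : ℂ) := by
  have hs' : ‖s‖ ≠ 0 := norm_ne_zero_iff.2 hs
  obtain ⟨e, he, he_inner, he_norm⟩ := exists_measurableEquiv_prod_axis s hs
  set H : ℝ × EuclideanSpace ℝ (Fin 2) → ℂ := fun p =>
    Complex.exp (-Complex.I * ((‖s‖ * p.1 : ℝ) : ℂ)) * (((if √(p.1 ^ 2 + ‖p.2‖ ^ 2) < L then
      √(p.1 ^ 2 + ‖p.2‖ ^ 2) else 0) / (8 * Real.pi) : ℝ) : ℂ) with hH
  have hHe : (Metric.ball (0 : EuclideanSpace ℝ (Fin 3)) L).indicator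
      (fun x => Complex.exp (-Complex.I * (⟪s, x⟫ : ℂ)) * ((‖x‖ / (8 * Real.pi) : ℝ) : ℂ)) =
      H ∘ e := by
    ext x
    simp only [hH, Function.comp_apply, ← he_inner, ← he_norm]
    by_cases hx : ‖x‖ < L <;> simp [Set.indicator, hx]
  have hint : Integrable H := by
    rw [← he.integrable_comp_emb e.measurableEmbedding, ← hHe,
      integrable_indicator_iff measurableSet_ball]
    refine IntegrableOn.mono_set (t := Metric.closedBall 0 L) ?_ Metric.ball_subset_closedBall
    exact ContinuousOn.integrableOn_compact (isCompact_closedBall 0 L)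
      (Continuous.continuousOn (by fun_prop))
  rw [← integral_indicator measurableSet_ball, hHe]
  change ∫ x, H (e x) = _
  rw [he.integral_comp', Measure.volume_eq_prod, integral_prod _ hint,
    ← integral_exp_mul_cube_sub hL hs', intervalIntegral.integral_of_le (by linarith),
    integral_Ioc_eq_integral_Ioo, ← integral_indicator measurableSet_Ioo]
  congr 1
  ext z
  simp only [hH]
  rw [integral_const_mul, integral_complex_ofReal, integral_div, integral_slice_norm hL z]
  by_cases hz : |z| < L
  · rw [if_pos hz, Set.indicator_of_mem (Set.mem_Ioo.2 (abs_lt.1 hz))]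
    congr 2
    field_simp
    ring
  · rw [if_neg hz, Set.indicator_of_notMem (fun h => hz (abs_lt.2 (Set.mem_Ioo.1 h)))]
    simp
end

section
/- Let L > 0. For every s ∈ ℝ² with s ≠ 0, writing σ = |s|, the Fourier transform of the truncated two-dimensional biharmonic Green's function satisfies ∫_{|x|<L} e^{−i⟨s,x⟩} (−(|x|²/(8π))(log|x| − 1)) dx = (J₀(Lσ) − 1)/σ⁴ − L³(log(L) − 1) J₁(Lσ)/(4σ) + L log(L) J₁(Lσ)/σ³ − L²(2 log(L) − 1) J₀(Lσ)/(4σ²). -/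
open MeasureTheory RealInnerProductSpace

theorem besselJ_zero_eq (x : ℝ) :
    besselJ 0 x = (1 / Real.pi) * ∫ θ in (0 : ℝ)..Real.pi, Real.cos (x * Real.sin θ) := by
  simp [besselJ]

theorem integral_cos_mul_cos_mul_sin (x : ℝ) :
    ∫ θ in (0 : ℝ)..Real.pi, Real.cos θ * Real.cos (x * Real.sin θ) = 0 := by
  have h := intervalIntegral.integral_comp_sub_left (a := 0) (b := Real.pi)
    (fun θ => Real.cos θ * Real.cos (x * Real.sin θ)) Real.pi
  simp only [Real.cos_pi_sub, Real.sin_pi_sub, sub_self, sub_zero, neg_mul,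
    intervalIntegral.integral_neg] at h
  linarith

theorem besselJ_one_eq (x : ℝ) :
    besselJ 1 x =
      (1 / Real.pi) * ∫ θ in (0 : ℝ)..Real.pi, Real.sin θ * Real.sin (x * Real.sin θ) := by
  have h : ∀ θ : ℝ, Real.cos ((1 : ℕ) * θ - x * Real.sin θ) =
      Real.cos θ * Real.cos (x * Real.sin θ) + Real.sin θ * Real.sin (x * Real.sin θ) := by
    intro θ
    rw [Nat.cast_one, one_mul, Real.cos_sub]
  rw [besselJ, intervalIntegral.integral_congr (fun θ _ => h θ),
    intervalIntegral.integral_add (Continuous.intervalIntegrable (by fun_prop) _ _)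
      (Continuous.intervalIntegrable (by fun_prop) _ _), integral_cos_mul_cos_mul_sin, zero_add]

theorem integral_sin_mul_sin_mul_sin (x : ℝ) :
    ∫ θ in (0 : ℝ)..Real.pi, Real.sin θ * Real.sin (x * Real.sin θ) =
      x * ∫ θ in (0 : ℝ)..Real.pi, Real.cos θ ^ 2 * Real.cos (x * Real.sin θ) := by
  have h := intervalIntegral.integral_eq_sub_of_hasDerivAt (a := 0) (b := Real.pi)
    (f := fun θ => Real.cos θ * Real.sin (x * Real.sin θ))
    (f' := fun θ => x * (Real.cos θ ^ 2 * Real.cos (x * Real.sin θ)) -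
      Real.sin θ * Real.sin (x * Real.sin θ))
    (fun θ _ => by
      refine ((Real.hasDerivAt_cos θ).mul
        ((Real.hasDerivAt_sin θ).const_mul x).sin).congr_deriv ?_
      ring)
    (Continuous.intervalIntegrable (by fun_prop) _ _)
  rw [intervalIntegral.integral_sub (Continuous.intervalIntegrable (by fun_prop) _ _)
    (Continuous.intervalIntegrable (by fun_prop) _ _),
    intervalIntegral.integral_const_mul] at h
  simp only [Real.sin_pi, Real.sin_zero, mul_zero, sub_zero] at h
  linarith

theorem hasDerivAt_besselJ_zero (x : ℝ) : HasDerivAt (besselJ 0) (-besselJ 1 x) x := by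
  have h := (intervalIntegral.hasDerivAt_integral_of_dominated_loc_of_deriv_le
    (μ := volume) (a := 0) (b := Real.pi) (x₀ := x) (s := Set.univ) (bound := fun _ => 1)
    (F := fun y θ => Real.cos (y * Real.sin θ))
    (F' := fun y θ => -(Real.sin θ * Real.sin (y * Real.sin θ)))
    Filter.univ_mem
    (Filter.Eventually.of_forall fun y => Continuous.aestronglyMeasurable (by fun_prop))
    (Continuous.intervalIntegrable (by fun_prop) _ _)
    (Continuous.aestronglyMeasurable (by fun_prop))
    (Filter.Eventually.of_forall fun θ _ y _ => by
      rw [norm_neg, norm_mul]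
      exact mul_le_one₀ (Real.abs_sin_le_one _) (norm_nonneg _) (Real.abs_sin_le_one _))
    intervalIntegrable_const
    (Filter.Eventually.of_forall fun θ _ y _ => by
      refine ((hasDerivAt_id y).mul_const (Real.sin θ)).cos.congr_deriv ?_
      simp [mul_comm])).2.const_mul (1 / Real.pi)
  rw [intervalIntegral.integral_neg, mul_neg, ← besselJ_one_eq] at h
  rwa [funext besselJ_zero_eq]

theorem hasDerivAt_besselJ_one (x : ℝ) :
    HasDerivAt (besselJ 1)
      ((1 / Real.pi) * ∫ θ in (0 : ℝ)..Real.pi, Real.sin θ ^ 2 * Real.cos (x * Real.sin θ)) x := by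
  have h := (intervalIntegral.hasDerivAt_integral_of_dominated_loc_of_deriv_le
    (μ := volume) (a := 0) (b := Real.pi) (x₀ := x) (s := Set.univ) (bound := fun _ => 1)
    (F := fun y θ => Real.sin θ * Real.sin (y * Real.sin θ))
    (F' := fun y θ => Real.sin θ ^ 2 * Real.cos (y * Real.sin θ))
    Filter.univ_mem
    (Filter.Eventually.of_forall fun y => Continuous.aestronglyMeasurable (by fun_prop))
    (Continuous.intervalIntegrable (by fun_prop) _ _)
    (Continuous.aestronglyMeasurable (by fun_prop))
    (Filter.Eventually.of_forall fun θ _ y _ => by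
      rw [norm_mul, norm_pow]
      exact mul_le_one₀ (pow_le_one₀ (norm_nonneg _) (Real.abs_sin_le_one _)) (norm_nonneg _)
        (Real.abs_cos_le_one _))
    intervalIntegrable_const
    (Filter.Eventually.of_forall fun θ _ y _ => by
      refine (((hasDerivAt_id y).mul_const (Real.sin θ)).sin.const_mul
        (Real.sin θ)).congr_deriv ?_
      simp only [id_eq]
      ring)).2.const_mul (1 / Real.pi)
  rwa [funext besselJ_one_eq]

theorem hasDerivAt_mul_besselJ_one (x : ℝ) :
    HasDerivAt (fun y => y * besselJ 1 y) (x * besselJ 0 x) x := by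
  refine ((hasDerivAt_id x).mul (hasDerivAt_besselJ_one x)).congr_deriv ?_
  have h : ∫ θ in (0 : ℝ)..Real.pi, Real.cos (x * Real.sin θ) =
      (∫ θ in (0 : ℝ)..Real.pi, Real.cos θ ^ 2 * Real.cos (x * Real.sin θ)) +
        ∫ θ in (0 : ℝ)..Real.pi, Real.sin θ ^ 2 * Real.cos (x * Real.sin θ) := by
    rw [← intervalIntegral.integral_add (Continuous.intervalIntegrable (by fun_prop) _ _)
      (Continuous.intervalIntegrable (by fun_prop) _ _)]
    refine intervalIntegral.integral_congr fun θ _ => ?_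
    simp only [← add_mul, Real.cos_sq_add_sin_sq, one_mul]
  rw [besselJ_zero_eq, h, besselJ_one_eq, integral_sin_mul_sin_mul_sin, id_eq]
  ring

theorem continuous_besselJ_zero : Continuous (besselJ 0) :=
  continuous_iff_continuousAt.2 fun x => (hasDerivAt_besselJ_zero x).continuousAt

theorem continuous_besselJ_one : Continuous (besselJ 1) :=
  continuous_iff_continuousAt.2 fun x => (hasDerivAt_besselJ_one x).continuousAt

/-- The integral of a plane wave over a circle. -/
theorem integral_exp_mul_cos_sub (z φ : ℝ) :
    ∫ θ in (-Real.pi)..Real.pi, Complex.exp (-Complex.I * ((z * Real.cos (θ - φ) : ℝ) : ℂ)) =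
      ((2 * Real.pi * besselJ 0 z : ℝ) : ℂ) := by
  set g : ℝ → ℂ := fun θ => Complex.exp (-Complex.I * ((z * Real.sin θ : ℝ) : ℂ)) with hg
  have hgc : Continuous g := by fun_prop
  have hper : Function.Periodic g (2 * Real.pi) := fun θ => by
    simp only [hg, Real.sin_add_two_pi]
  have hshift : ∀ θ : ℝ, Complex.exp (-Complex.I * ((z * Real.cos (θ - φ) : ℝ) : ℂ)) =
      g (θ + (Real.pi / 2 - φ)) := fun θ => by
    simp only [hg]
    rw [← Real.sin_add_pi_div_two, show θ - φ + Real.pi / 2 = θ + (Real.pi / 2 - φ) by ring]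
  have hsum : ∀ θ : ℝ, g (-θ) + g θ = ((2 * Real.cos (z * Real.sin θ) : ℝ) : ℂ) := fun θ => by
    simp only [hg, Real.sin_neg]
    rw [Complex.ofReal_mul 2, Complex.ofReal_cos, Complex.ofReal_ofNat, Complex.two_cos]
    congr 2 <;> push_cast <;> ring
  calc
    _ = ∫ θ in (-Real.pi + (Real.pi / 2 - φ))..(Real.pi + (Real.pi / 2 - φ)), g θ := by
      rw [← intervalIntegral.integral_comp_add_right]
      exact intervalIntegral.integral_congr fun θ _ => hshift θ
    _ = ∫ θ in (-Real.pi)..Real.pi, g θ := by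
      have h := hper.intervalIntegral_add_eq (-Real.pi + (Real.pi / 2 - φ)) (-Real.pi)
      rwa [show -Real.pi + (Real.pi / 2 - φ) + 2 * Real.pi = Real.pi + (Real.pi / 2 - φ) by ring,
        show -Real.pi + 2 * Real.pi = Real.pi by ring] at h
    _ = (∫ θ in (0 : ℝ)..Real.pi, g (-θ)) + ∫ θ in (0 : ℝ)..Real.pi, g θ := by
      rw [intervalIntegral.integral_comp_neg, neg_zero,
        intervalIntegral.integral_add_adjacent_intervals (hgc.intervalIntegrable _ _)
          (hgc.intervalIntegrable _ _)]
    _ = _ := by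
      have hgn : Continuous fun θ => g (-θ) := hgc.comp continuous_neg
      rw [← intervalIntegral.integral_add (hgn.intervalIntegrable _ _)
        (hgc.intervalIntegrable _ _), intervalIntegral.integral_congr (fun θ _ => hsum θ),
        intervalIntegral.integral_ofReal, intervalIntegral.integral_const_mul, besselJ_zero_eq]
      congr 1
      field_simp

/-- The Hankel-type radial integral of the biharmonic kernel. -/
theorem integral_cube_mul_log_mul_besselJ_zero {L σ : ℝ} (hL : 0 < L) (hσ : σ ≠ 0) :
    ∫ r in (0 : ℝ)..L, -(r ^ 2 * (r * Real.log r - r) / 4) * besselJ 0 (r * σ) =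
      (besselJ 0 (L * σ) - 1) / σ ^ 4 -
          L ^ 3 * (Real.log L - 1) * besselJ 1 (L * σ) / (4 * σ) +
          L * Real.log L * besselJ 1 (L * σ) / σ ^ 3 -
          L ^ 2 * (2 * Real.log L - 1) * besselJ 0 (L * σ) / (4 * σ ^ 2) := by
  have hlog := Real.continuous_mul_log
  have h0 := continuous_besselJ_zero
  have h1 := continuous_besselJ_one
  have hJ0 : besselJ 0 0 = 1 := by
    simp [besselJ, Real.pi_ne_zero]
  have h := intervalIntegral.integral_eq_sub_of_hasDerivAt_of_le hL.le
    (f := fun r => (besselJ 0 (r * σ) - 1) / σ ^ 4 -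
          r ^ 2 * (r * Real.log r - r) * besselJ 1 (r * σ) / (4 * σ) +
          r * Real.log r * besselJ 1 (r * σ) / σ ^ 3 -
          r * (2 * (r * Real.log r) - r) * besselJ 0 (r * σ) / (4 * σ ^ 2))
    (f' := fun r => -(r ^ 2 * (r * Real.log r - r) / 4) * besselJ 0 (r * σ))
    (Continuous.continuousOn (by fun_prop))
    (fun r hr => by
      have hr0 : r ≠ 0 := hr.1.ne'
      have hid := hasDerivAt_id r
      have hs : HasDerivAt (fun y : ℝ => y * σ) σ r := by simpa using hid.mul_const σ
      have d0 := (hasDerivAt_besselJ_zero (r * σ)).comp r hs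
      have d1 := ((hasDerivAt_mul_besselJ_one (r * σ)).comp r hs).div_const σ
      have dl := Real.hasDerivAt_log hr0
      have d := ((((d0.sub_const 1).div_const (σ ^ 4)).sub
        ((((hid.pow 2).mul (dl.sub_const 1)).mul d1).div_const (4 * σ))).add
        ((dl.mul d1).div_const (σ ^ 3))).sub
        ((((hid.pow 2).mul ((dl.const_mul 2).sub_const 1)).mul d0).div_const (4 * σ ^ 2))
      convert d using 1
      · funext y
        simp only [Function.comp, Pi.mul_apply, Pi.pow_apply, id_eq, Pi.add_apply, Pi.sub_apply]
        field_simp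
      · simp only [Function.comp, Pi.mul_apply, Pi.pow_apply, id_eq]
        field_simp
        ring)
    (Continuous.intervalIntegrable (by fun_prop) _ _)
  rw [h]
  simp only [zero_mul, hJ0]
  ring

/-- The Fourier transform of the truncated biharmonic kernel on `ℂ`, reduced to a radial integral. -/
theorem setIntegral_ball_exp_inner_mul_biharmonic {L σ φ : ℝ} (hL : 0 < L) :
    ∫ w in Metric.ball (0 : ℂ) L,
        Complex.exp (-Complex.I *
            ((⟪((σ * (Real.cos φ + Real.sin φ * Complex.I) : ℂ)), w⟫ : ℝ) : ℂ)) *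
          ((-(‖w‖ ^ 2 / (8 * Real.pi)) * (Real.log ‖w‖ - 1) : ℝ) : ℂ) =
      ((∫ r in (0 : ℝ)..L, -(r ^ 2 * (r * Real.log r - r) / 4) * besselJ 0 (r * σ) : ℝ) : ℂ) := by
  set G : ℝ × ℝ → ℂ := fun p =>
    Complex.exp (-Complex.I * ((p.1 * σ * Real.cos (p.2 - φ) : ℝ) : ℂ)) *
      ((-(p.1 ^ 2 * (p.1 * Real.log p.1 - p.1) / (8 * Real.pi)) : ℝ) : ℂ) with hG
  have hGc : Continuous G := by
    have hlog := Real.continuous_mul_log.comp (continuous_fst (X := ℝ) (Y := ℝ))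
    simp only [Function.comp_def] at hlog
    fun_prop
  have hGi : IntegrableOn G (Set.Ioo 0 L ×ˢ Set.Ioo (-Real.pi) Real.pi)
      (volume.prod volume) := by
    refine IntegrableOn.mono_set (t := Set.Icc 0 L ×ˢ Set.Icc (-Real.pi) Real.pi) ?_
      (Set.prod_mono Set.Ioo_subset_Icc_self Set.Ioo_subset_Icc_self)
    exact hGc.continuousOn.integrableOn_compact (isCompact_Icc.prod isCompact_Icc)
  rw [← integral_indicator Metric.isOpen_ball.measurableSet,
    ← Complex.integral_comp_polarCoord_symm, polarCoord_target]
  have hind : ∀ p ∈ Set.Ioi (0 : ℝ) ×ˢ Set.Ioo (-Real.pi) Real.pi,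
      p.1 • (Metric.ball (0 : ℂ) L).indicator (fun w =>
        Complex.exp (-Complex.I *
            ((⟪((σ * (Real.cos φ + Real.sin φ * Complex.I) : ℂ)), w⟫ : ℝ) : ℂ)) *
          ((-(‖w‖ ^ 2 / (8 * Real.pi)) * (Real.log ‖w‖ - 1) : ℝ) : ℂ))
          (Complex.polarCoord.symm p) =
      (Set.Iio L ×ˢ Set.univ).indicator G p := by
    rintro ⟨r, θ⟩ ⟨hr, -⟩
    have hr : 0 < r := hr
    have hn := Complex.norm_polarCoord_symm (r, θ)
    rw [abs_of_pos hr] at hn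
    by_cases hrL : r < L
    · rw [Set.indicator_of_mem (by rw [mem_ball_zero_iff, hn]; exact hrL),
        Set.indicator_of_mem (by simpa using hrL), hn]
      have hin : ⟪((σ * (Real.cos φ + Real.sin φ * Complex.I) : ℂ)),
          Complex.polarCoord.symm (r, θ)⟫ = r * σ * Real.cos (θ - φ) := by
        rw [Complex.inner, Complex.polarCoord_symm_apply, Real.cos_sub]
        simp [-Complex.ofReal_cos, -Complex.ofReal_sin]
        ring
      rw [hin, hG, Complex.real_smul, mul_left_comm, ← Complex.ofReal_mul]
      congr 2
      ring
    · rw [Set.indicator_of_notMem (by rw [mem_ball_zero_iff, hn]; exact hrL),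
        Set.indicator_of_notMem (by simpa using hrL), smul_zero]
  rw [setIntegral_congr_fun (measurableSet_Ioi.prod measurableSet_Ioo) hind,
    setIntegral_indicator (measurableSet_Iio.prod MeasurableSet.univ), Set.prod_inter_prod,
    Set.Ioi_inter_Iio, Set.inter_univ, Measure.volume_eq_prod, setIntegral_prod _ hGi,
    ← integral_Ioc_eq_integral_Ioo, ← intervalIntegral.integral_of_le hL.le,
    ← intervalIntegral.integral_ofReal]
  refine intervalIntegral.integral_congr fun r _ => ?_
  simp only [hG]
  rw [← integral_Ioc_eq_integral_Ioo,
    ← intervalIntegral.integral_of_le (by linarith [Real.pi_pos]),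
    intervalIntegral.integral_mul_const, integral_exp_mul_cos_sub, ← Complex.ofReal_mul]
  congr 1
  have := Real.pi_ne_zero
  field_simp
  ring

/-- The Fourier transform of the truncated 2D biharmonic kernel
`(−(|x|²/(8π))(log|x| − 1))·1_{|x|<L}` is
`(J₀(Lσ) − 1)/σ⁴ − L³(log L − 1)J₁(Lσ)/(4σ) + L log(L) J₁(Lσ)/σ³ − L²(2 log L − 1)J₀(Lσ)/(4σ²)`,
with `σ = |s|`. -/
theorem stmt_7 (L : ℝ) (hL : 0 < L)
    (s : EuclideanSpace ℝ (Fin 2)) (hs : s ≠ 0) :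
    ∫ x in Metric.ball (0 : EuclideanSpace ℝ (Fin 2)) L,
        Complex.exp (-Complex.I * (⟪s, x⟫ : ℂ)) *
          ((-(‖x‖ ^ 2 / (8 * Real.pi)) * (Real.log ‖x‖ - 1) : ℝ) : ℂ) =
      (((besselJ 0 (L * ‖s‖) - 1) / ‖s‖ ^ 4 -
          L ^ 3 * (Real.log L - 1) * besselJ 1 (L * ‖s‖) / (4 * ‖s‖) +
          L * Real.log L * besselJ 1 (L * ‖s‖) / ‖s‖ ^ 3 -
          L ^ 2 * (2 * Real.log L - 1) * besselJ 0 (L * ‖s‖) / (4 * ‖s‖ ^ 2) : ℝ) : ℂ) := by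
  set e := Complex.orthonormalBasisOneI.repr
  obtain ⟨φ, hφ⟩ : ∃ φ : ℝ, e.symm s = (‖s‖ * (Real.cos φ + Real.sin φ * Complex.I) : ℂ) := by
    refine ⟨(e.symm s).arg, ?_⟩
    rw [← e.symm.norm_map s, Complex.ofReal_cos, Complex.ofReal_sin,
      Complex.norm_mul_cos_add_sin_mul_I]
  rw [← integral_cube_mul_log_mul_besselJ_zero hL (norm_ne_zero_iff.2 hs),
    ← setIntegral_ball_exp_inner_mul_biharmonic (φ := φ) hL, ← hφ,
    ← e.measurePreserving.setIntegral_preimage_emb e.toMeasurableEquiv.measurableEmbedding]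
  have hball : e ⁻¹' Metric.ball 0 L = Metric.ball 0 L := by
    rw [e.preimage_ball, map_zero]
  have hin : ∀ w : ℂ, ⟪s, e w⟫ = ⟪e.symm s, w⟫ := fun w => by
    rw [← e.inner_map_map, e.apply_symm_apply]
  rw [hball]
  simp only [hin, e.norm_map]
end

section
/- Let L > 0 and let h ∈ ℝ³ with h ≠ 0. Define the convected Helmholtz kernel g_h(x) = (e^{i|h||x|}/(4π|x|)) e^{i⟨h,x⟩}. Then for every s ∈ ℝ³ such that σ := |s − h| satisfies σ ≠ 0 and σ ≠ |h|, the Fourier transform of the truncated kernel satisfies ∫_{|x|<L} e^{−i⟨s,x⟩} g_h(x) dx = (−1 + e^{iL|h|}(cos(Lσ) − i (|h|/σ) sin(Lσ))) / ((|h| − σ)(|h| + σ)); that is, it equals the Fourier transform of the truncated Helmholtz kernel with wavenumber k = |h| evaluated at radius |s − h|. -/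
open MeasureTheory RealInnerProductSpace

/-- Cylindrical coordinates around the axis spanned by `w`. -/
lemma exists_measurableEquiv_real_prod_complex (w : EuclideanSpace ℝ (Fin 3)) (hw : w ≠ 0) :
    ∃ e : EuclideanSpace ℝ (Fin 3) ≃ᵐ ℝ × ℂ, MeasurePreserving e ∧
      ∀ x, ⟪w, x⟫ = ‖w‖ * (e x).1 ∧ ‖x‖ = √((e x).1 ^ 2 + ‖(e x).2‖ ^ 2) := by
  have hwn : ‖w‖ ≠ 0 := norm_ne_zero_iff.mpr hw
  obtain ⟨b, hb⟩ := Orthonormal.exists_orthonormalBasis_extension_of_card_eq (𝕜 := ℝ)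
    (E := EuclideanSpace ℝ (Fin 3)) (ι := Fin 3) (by simp)
    (v := fun _ => (‖w‖⁻¹ : ℝ) • w) (s := {0}) (by
      constructor
      · intro i
        simp [norm_smul, hwn]
      · intro i j hij
        exact absurd (Subsingleton.elim i j) hij)
  have hb0 : b 0 = (‖w‖⁻¹ : ℝ) • w := hb 0 rfl
  refine ⟨(b.repr.toMeasurableEquiv.trans (MeasurableEquiv.toLp 2 (Fin 3 → ℝ)).symm).trans
    ((MeasurableEquiv.piFinSuccAbove (fun _ : Fin 3 => ℝ) 0).trans
      (MeasurableEquiv.prodCongr (MeasurableEquiv.refl ℝ) Complex.measurableEquivPi.symm)), ?_, ?_⟩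
  · have h₁ := (PiLp.volume_preserving_ofLp (Fin 3)).comp b.repr.measurePreserving
    have h₂ := (volume_preserving_piFinSuccAbove (fun _ : Fin 3 => ℝ) 0).comp h₁
    exact ((MeasurePreserving.id volume).prod Complex.volume_preserving_equiv_pi.symm).comp h₂
  · intro x
    have h1 : ⟪w, x⟫ = ‖w‖ * b.repr x 0 := by
      rw [b.repr_apply_apply, hb0, real_inner_smul_left]
      field_simp
    have h2 : ‖x‖ = √((b.repr x 0) ^ 2 + ((b.repr x 1) ^ 2 + (b.repr x 2) ^ 2)) := by
      rw [← b.repr.norm_map x, EuclideanSpace.norm_eq, Fin.sum_univ_three]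
      simp [add_assoc]
    refine ⟨h1, ?_⟩
    rw [h2]
    congr 2
    rw [Complex.sq_norm, Complex.normSq_apply, ← sq, ← sq]
    change _ = (Complex.measurableEquivPi.symm ![b.repr x 1, b.repr x 2]).re ^ 2 +
      (Complex.measurableEquivPi.symm ![b.repr x 1, b.repr x 2]).im ^ 2
    simp [Complex.measurableEquivPi_symm_apply]

/-- Integral of the truncated Helmholtz kernel over the plane at height `t`. -/
lemma integral_truncated_helmholtz_plane (L k : ℝ) (hk : k ≠ 0) (t : ℝ) (ht : t ≠ 0) :
    ∫ z : ℂ, (Set.Iio L).indicator (fun r : ℝ => Complex.exp (Complex.I * k * r) /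
        ((4 * Real.pi * r : ℝ) : ℂ)) (√(t ^ 2 + ‖z‖ ^ 2)) =
      if |t| < L then (Complex.exp (Complex.I * k * L) - Complex.exp (Complex.I * k * |t|)) /
        (2 * Complex.I * k) else 0 := by
  have hr : ∀ y : ℝ, 0 < t ^ 2 + y ^ 2 := fun y => by positivity
  rw [integral_fun_norm_addHaar volume (fun y : ℝ => (Set.Iio L).indicator
    (fun r : ℝ => Complex.exp (Complex.I * k * r) / ((4 * Real.pi * r : ℝ) : ℂ))
      (√(t ^ 2 + y ^ 2)))]
  have hv : (volume : Measure ℂ).real (Metric.ball 0 1) = Real.pi := by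
    simp [Measure.real, Complex.volume_ball]
  rw [hv, Complex.finrank_real_complex]
  split_ifs with hL
  · have hL0 : 0 < L := (abs_nonneg t).trans_lt hL
    have htL : t ^ 2 < L ^ 2 := by rw [← sq_abs t]; gcongr
    set R := √(L ^ 2 - t ^ 2) with hR
    have hR2 : R ^ 2 = L ^ 2 - t ^ 2 := Real.sq_sqrt (by linarith)
    have hR0 : 0 ≤ R := Real.sqrt_nonneg _
    have hlt : ∀ y : ℝ, 0 < y → (√(t ^ 2 + y ^ 2) < L ↔ y < R) := by
      intro y hy
      rw [Real.sqrt_lt' hL0, hR, Real.lt_sqrt hy.le]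
      constructor <;> intro h <;> linarith
    have hftc : ∫ y in (0 : ℝ)..R, (y : ℂ) * (Complex.exp (Complex.I * k * (√(t ^ 2 + y ^ 2) : ℝ)) /
        ((4 * Real.pi * √(t ^ 2 + y ^ 2) : ℝ) : ℂ)) =
        Complex.exp (Complex.I * k * (√(t ^ 2 + R ^ 2) : ℝ)) / (4 * Real.pi * Complex.I * k) -
        Complex.exp (Complex.I * k * (√(t ^ 2 + 0 ^ 2) : ℝ)) / (4 * Real.pi * Complex.I * k) := by
      refine intervalIntegral.integral_eq_sub_of_hasDerivAt
        (f := fun y : ℝ => Complex.exp (Complex.I * k * (√(t ^ 2 + y ^ 2) : ℝ)) /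
          (4 * Real.pi * Complex.I * k)) ?_ ?_
      · intro y _
        have hs : √(t ^ 2 + y ^ 2) ≠ 0 := (Real.sqrt_pos.mpr (hr y)).ne'
        have h1 : HasDerivAt (fun y : ℝ => √(t ^ 2 + y ^ 2))
            ((2 * y) / (2 * √(t ^ 2 + y ^ 2))) y := by
          refine HasDerivAt.sqrt ?_ (hr y).ne'
          simpa using (hasDerivAt_pow 2 y).const_add (t ^ 2)
        have h2 := ((h1.ofReal_comp.const_mul (Complex.I * k)).cexp).div_const
          (4 * Real.pi * Complex.I * k)
        refine h2.congr_deriv ?_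
        have hs' : ((√(t ^ 2 + y ^ 2) : ℝ) : ℂ) ≠ 0 := by exact_mod_cast hs
        have hk' : (k : ℂ) ≠ 0 := by exact_mod_cast hk
        have hpi : (Real.pi : ℂ) ≠ 0 := by exact_mod_cast Real.pi_ne_zero
        have hI := Complex.I_ne_zero
        push_cast
        generalize ((√(t ^ 2 + y ^ 2) : ℝ) : ℂ) = q at *
        field_simp
      · apply Continuous.intervalIntegrable
        have : ∀ y : ℝ, ((4 * Real.pi * √(t ^ 2 + y ^ 2) : ℝ) : ℂ) ≠ 0 := by
          intro y
          have := (Real.sqrt_pos.mpr (hr y)).ne'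
          have := Real.pi_ne_zero
          norm_cast
          positivity
        fun_prop (disch := exact this _)
    have hset : ∫ y in Set.Ioi (0 : ℝ), y ^ (2 - 1) • (Set.Iio L).indicator
        (fun r : ℝ => Complex.exp (Complex.I * k * r) / ((4 * Real.pi * r : ℝ) : ℂ))
        (√(t ^ 2 + y ^ 2)) = ∫ y in (0 : ℝ)..R, (y : ℂ) *
        (Complex.exp (Complex.I * k * (√(t ^ 2 + y ^ 2) : ℝ)) /
        ((4 * Real.pi * √(t ^ 2 + y ^ 2) : ℝ) : ℂ)) := by
      rw [intervalIntegral.integral_of_le hR0, integral_Ioc_eq_integral_Ioo,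
        ← Set.Ioi_inter_Iio, ← setIntegral_indicator measurableSet_Iio]
      refine setIntegral_congr_fun measurableSet_Ioi fun y hy => ?_
      by_cases hyR : y < R
      · simp [Set.indicator, hyR, (hlt y hy).2 hyR]
      · simp [Set.indicator, hyR, (hlt y hy).not.2 hyR]
    rw [hset, hftc, hR2]
    have e1 : √(t ^ 2 + (L ^ 2 - t ^ 2)) = L := by
      rw [add_sub_cancel, Real.sqrt_sq hL0.le]
    have e2 : √(t ^ 2 + 0 ^ 2) = |t| := by simp [Real.sqrt_sq_eq_abs]
    rw [e1, e2]
    have hk' : (k : ℂ) ≠ 0 := by exact_mod_cast hk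
    have hpi : (Real.pi : ℂ) ≠ 0 := by exact_mod_cast Real.pi_ne_zero
    simp only [nsmul_eq_mul, Complex.real_smul]
    push_cast
    field_simp
    ring
  · have : ∀ y : ℝ, ¬ √(t ^ 2 + y ^ 2) < L := by
      intro y
      have : |t| ≤ √(t ^ 2 + y ^ 2) := Real.abs_le_sqrt (by nlinarith [sq_nonneg y])
      linarith
    simp [Set.indicator, this]

/-- One-dimensional Fourier transform of the plane integrals of the truncated kernel. -/
lemma integral_exp_mul_truncated_helmholtz_plane (L k σ : ℝ) (hL : 0 < L) (hk : k ≠ 0) (hσ : σ ≠ 0) (h1 : k - σ ≠ 0)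
    (h2 : k + σ ≠ 0) :
    ∫ t : ℝ, Complex.exp (-Complex.I * (σ * t : ℝ)) * (if |t| < L then
      (Complex.exp (Complex.I * k * L) - Complex.exp (Complex.I * k * |t|)) /
        (2 * Complex.I * k) else 0) =
      (-1 + Complex.exp (Complex.I * L * k) * ((Real.cos (L * σ) : ℂ) -
        Complex.I * ((k / σ : ℝ) : ℂ) * (Real.sin (L * σ) : ℂ))) /
        (((k - σ) * (k + σ) : ℝ) : ℂ) := by
  have hk' : (k : ℂ) ≠ 0 := by exact_mod_cast hk
  have hσ' : (σ : ℂ) ≠ 0 := by exact_mod_cast hσ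
  have h1' : (k : ℂ) - σ ≠ 0 := by exact_mod_cast h1
  have h2' : (k : ℂ) + σ ≠ 0 := by exact_mod_cast h2
  set f : ℝ → ℂ := fun t => Complex.exp (-Complex.I * (σ * t : ℝ)) *
    ((Complex.exp (Complex.I * k * L) - Complex.exp (Complex.I * k * |t|)) /
        (2 * Complex.I * k)) with hf
  have hfc : Continuous f := by
    rw [hf]
    fun_prop
  have e1 : ∫ t : ℝ, Complex.exp (-Complex.I * (σ * t : ℝ)) * (if |t| < L then
      (Complex.exp (Complex.I * k * L) - Complex.exp (Complex.I * k * |t|)) /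
        (2 * Complex.I * k) else 0) = ∫ t in (-L)..L, f t := by
    rw [intervalIntegral.integral_of_le (by linarith), integral_Ioc_eq_integral_Ioo,
      ← integral_indicator measurableSet_Ioo]
    congr 1 with t
    by_cases h : |t| < L
    · simp [Set.indicator, h, abs_lt.1 h, hf]
    · simp [Set.indicator, h, ← abs_lt]
  have e2 : ∫ t in (-L)..L, f t = ∫ t in (0 : ℝ)..L, (f (-t) + f t) := by
    rw [intervalIntegral.integral_add (f := fun t => f (-t))
      ((hfc.comp continuous_neg).intervalIntegrable _ _)
      (hfc.intervalIntegrable _ _), intervalIntegral.integral_comp_neg, neg_zero,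
      intervalIntegral.integral_add_adjacent_intervals (hfc.intervalIntegrable _ _)
      (hfc.intervalIntegrable _ _)]
  have hd : ∀ (c : ℂ) (t : ℝ), HasDerivAt (fun t : ℝ => Complex.exp (c * t))
      (Complex.exp (c * t) * c) t := by
    intro c t
    simpa using (((hasDerivAt_id t).ofReal_comp.const_mul c).cexp)
  have e3 : ∫ t in (0 : ℝ)..L, (f (-t) + f t) = ∫ t in (0 : ℝ)..L,
      (Complex.exp (Complex.I * k * L) * (Complex.exp (Complex.I * σ * t) +
        Complex.exp (-(Complex.I * σ) * t)) - Complex.exp (Complex.I * (k + σ) * t) -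
          Complex.exp (Complex.I * (k - σ) * t)) / (2 * Complex.I * k) := by
    refine intervalIntegral.integral_congr fun t ht => ?_
    rw [Set.uIcc_of_le hL.le] at ht
    have a1 : Complex.exp (Complex.I * (k + σ) * t) =
      Complex.exp (Complex.I * k * t) * Complex.exp (Complex.I * σ * t) := by
      rw [← Complex.exp_add]; ring_nf
    have a2 : Complex.exp (Complex.I * (k - σ) * t) =
      Complex.exp (Complex.I * k * t) * Complex.exp (-(Complex.I * σ) * t) := by
      rw [← Complex.exp_add]; ring_nf
    have a3 : -Complex.I * ((σ * t : ℝ) : ℂ) = -(Complex.I * σ) * t := by push_cast; ring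
    have a4 : -Complex.I * ((σ * -t : ℝ) : ℂ) = Complex.I * σ * t := by push_cast; ring
    simp only [hf, abs_neg, abs_of_nonneg ht.1, a1, a2, a3, a4]
    ring
  have e4 := intervalIntegral.integral_eq_sub_of_hasDerivAt (a := 0) (b := L)
    (f := fun t : ℝ => (Complex.exp (Complex.I * k * L) *
      (Complex.exp (Complex.I * σ * t) / (Complex.I * σ) +
        Complex.exp (-(Complex.I * σ) * t) / (-(Complex.I * σ))) -
        Complex.exp (Complex.I * (k + σ) * t) / (Complex.I * (k + σ)) -
          Complex.exp (Complex.I * (k - σ) * t) / (Complex.I * (k - σ))) / (2 * Complex.I * k))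
    (f' := fun t : ℝ => (Complex.exp (Complex.I * k * L) * (Complex.exp (Complex.I * σ * t) +
        Complex.exp (-(Complex.I * σ) * t)) - Complex.exp (Complex.I * (k + σ) * t) -
          Complex.exp (Complex.I * (k - σ) * t)) / (2 * Complex.I * k))
    (fun t _ => by
      have hc : ∀ c : ℂ, c ≠ 0 → HasDerivAt (fun t : ℝ => Complex.exp (c * t) / c)
          (Complex.exp (c * t)) t := fun c hc => by
        simpa [hc] using (hd c t).div_const c
      have hI := Complex.I_ne_zero
      exact (((((hc _ (mul_ne_zero hI hσ')).add (hc _ (neg_ne_zero.2 (mul_ne_zero hI hσ')))).const_mul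
        _).sub (hc _ (mul_ne_zero hI h2'))).sub (hc _ (mul_ne_zero hI h1'))).div_const _)
    (Continuous.intervalIntegrable (by fun_prop) _ _)
  rw [e1, e2, e3, e4]
  have b1 : Complex.exp (Complex.I * (k + σ) * L) =
      Complex.exp (Complex.I * k * L) * Complex.exp (Complex.I * σ * L) := by
    rw [← Complex.exp_add]; ring_nf
  have b2 : Complex.exp (Complex.I * (k - σ) * L) =
      Complex.exp (Complex.I * k * L) * Complex.exp (-(Complex.I * σ) * L) := by
    rw [← Complex.exp_add]; ring_nf
  have b3 : Complex.exp (Complex.I * σ * L) = Complex.cos (L * σ) + Complex.sin (L * σ) * Complex.I := by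
    rw [← Complex.exp_mul_I]; ring_nf
  have b4 : Complex.exp (-(Complex.I * σ) * L) =
      Complex.cos (L * σ) - Complex.sin (L * σ) * Complex.I := by
    rw [Complex.cos_sub_sin_I]; ring_nf
  have b5 : Complex.exp (Complex.I * L * k) = Complex.exp (Complex.I * k * L) := by ring_nf
  rw [b1, b2, b3, b4, b5]
  push_cast
  simp only [mul_zero, Complex.exp_zero]
  generalize Complex.exp (Complex.I * k * L) = E
  generalize Complex.cos (L * σ) = C
  generalize Complex.sin (L * σ) = S
  have hI := Complex.I_ne_zero
  have hI2 := Complex.I_sq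
  field_simp
  simp only [hI2]
  ring_nf

/-- The Fourier transform of the truncated 3D convected Helmholtz kernel
`g_h(x) = (e^{i|h||x|}/(4π|x|)) e^{i⟨h,x⟩}` restricted to `|x| < L` equals the Fourier
transform of the truncated Helmholtz kernel with wavenumber `k = |h|` evaluated at
radius `σ = |s − h|`. -/
theorem stmt_8 (L : ℝ) (hL : 0 < L)
    (h : EuclideanSpace ℝ (Fin 3)) (hh : h ≠ 0)
    (s : EuclideanSpace ℝ (Fin 3)) (hσ0 : ‖s - h‖ ≠ 0) (hσk : ‖s - h‖ ≠ ‖h‖) :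
    ∫ x in Metric.ball (0 : EuclideanSpace ℝ (Fin 3)) L,
        Complex.exp (-Complex.I * (⟪s, x⟫ : ℂ)) *
          (Complex.exp (Complex.I * (‖h‖ : ℂ) * (‖x‖ : ℂ)) / ((4 * Real.pi * ‖x‖ : ℝ) : ℂ) *
            Complex.exp (Complex.I * (⟪h, x⟫ : ℂ))) =
      (-1 + Complex.exp (Complex.I * (L : ℂ) * (‖h‖ : ℂ)) *
          ((Real.cos (L * ‖s - h‖) : ℂ) -
            Complex.I * ((‖h‖ / ‖s - h‖ : ℝ) : ℂ) * (Real.sin (L * ‖s - h‖) : ℂ))) /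
        (((‖h‖ - ‖s - h‖) * (‖h‖ + ‖s - h‖) : ℝ) : ℂ) := by
  have hk : ‖h‖ ≠ 0 := norm_ne_zero_iff.2 hh
  obtain ⟨e, he, hex⟩ := exists_measurableEquiv_real_prod_complex (s - h) (norm_ne_zero_iff.1 hσ0)
  set k := ‖h‖
  set σ := ‖s - h‖
  set F : ℝ → ℂ := (Set.Iio L).indicator (fun r : ℝ => Complex.exp (Complex.I * k * r) /
        ((4 * Real.pi * r : ℝ) : ℂ)) with hF
  set H : ℝ × ℂ → ℂ := fun p => Complex.exp (-Complex.I * (σ * p.1 : ℝ)) *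
    F (√(p.1 ^ 2 + ‖p.2‖ ^ 2)) with hH
  have hHe : ∀ x, H (e x) = Complex.exp (-Complex.I * (⟪s - h, x⟫ : ℝ)) * F ‖x‖ := by
    intro x
    simp only [hH]
    rw [← (hex x).2, ← (hex x).1]
  have hFi : Integrable (fun x : EuclideanSpace ℝ (Fin 3) => F ‖x‖) := by
    have hi : IntegrableOn (fun x : EuclideanSpace ℝ (Fin 3) =>
        (fun r : ℝ => Complex.exp (Complex.I * k * r) / ((4 * Real.pi * r : ℝ) : ℂ)) ‖x‖)
        (Metric.ball 0 L) := by
      rw [integrableOn_fun_norm_addHaar volume (f := fun r : ℝ => Complex.exp (Complex.I * k * r) /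
        ((4 * Real.pi * r : ℝ) : ℂ)), finrank_euclideanSpace, Fintype.card_fin]
      have : Continuous (fun y : ℝ => ((y / (4 * Real.pi) : ℝ) : ℂ) *
        Complex.exp (Complex.I * k * y)) := by fun_prop
      refine ((this.integrableOn_Icc (a := 0) (b := L)).mono_set Set.Ioo_subset_Icc_self).congr_fun
        (fun y hy => ?_) measurableSet_Ioo
      have hy0 : (y : ℂ) ≠ 0 := by exact_mod_cast hy.1.ne'
      have hpi : (Real.pi : ℂ) ≠ 0 := by exact_mod_cast Real.pi_ne_zero
      simp only [Complex.real_smul]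
      push_cast
      field_simp
    rw [← integrable_indicator_iff Metric.isOpen_ball.measurableSet] at hi
    refine hi.congr (.of_forall fun x => ?_)
    simp [hF, Set.indicator]
  have hHi : Integrable H := by
    rw [← he.integrable_comp_emb e.measurableEmbedding]
    have : H ∘ e = fun x => Complex.exp (-Complex.I * (⟪s - h, x⟫ : ℝ)) * F ‖x‖ := funext hHe
    rw [this]
    refine hFi.bdd_mul (c := 1) (Continuous.aestronglyMeasurable (by fun_prop))
      (.of_forall fun x => ?_)
    rw [Complex.norm_exp]
    simp
  calc _ = ∫ x, H (e x) := by
        rw [← integral_indicator Metric.isOpen_ball.measurableSet]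
        congr 1 with x
        rw [hHe]
        by_cases hx : ‖x‖ < L
        · simp only [Set.indicator, mem_ball_zero_iff, hx, if_true, hF, Set.mem_Iio]
          have : Complex.exp (-Complex.I * (⟪s - h, x⟫ : ℝ)) =
            Complex.exp (-Complex.I * (⟪s, x⟫ : ℝ)) * Complex.exp (Complex.I * (⟪h, x⟫ : ℝ)) := by
            rw [← Complex.exp_add, inner_sub_left]
            push_cast
            ring_nf
          rw [this]
          ring
        · simp [Set.indicator, hx, hF]
    _ = ∫ p, H p := he.integral_comp' H
    _ = ∫ t : ℝ, ∫ z : ℂ, H (t, z) := integral_prod H hHi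
    _ = ∫ t : ℝ, Complex.exp (-Complex.I * (σ * t : ℝ)) * (if |t| < L then
      (Complex.exp (Complex.I * k * L) - Complex.exp (Complex.I * k * |t|)) /
        (2 * Complex.I * k) else 0) := by
      refine integral_congr_ae ?_
      filter_upwards [Measure.ae_ne volume (0 : ℝ)] with t ht
      simp only [hH]
      rw [integral_const_mul, hF, integral_truncated_helmholtz_plane L k hk t ht]
    _ = _ := integral_exp_mul_truncated_helmholtz_plane L k σ hL hk hσ0 (sub_ne_zero.2 hσk.symm) (by positivity)
end

section
/- Let D = [-1/2,1/2]³, let L > √3, and let k > 0. Let f : ℝ³ → ℂ be smooth with support contained in D, and define F(s) = ∫_{ℝ³} e^{−i⟨s,y⟩} f(y) dy. Define G(s) = (−1 + e^{iLk}(cos(L|s|) − i (k/|s|) sin(L|s|))) / ((k − |s|)(k + |s|)) for |s| ∉ {0, k}. Then for every x ∈ D, the Helmholtz volume potential admits the spectral representation ∫_D (e^{ik|x−y|}/(4π|x−y|)) f(y) dy = (1/(2π)³) ∫_{ℝ³} e^{i⟨s,x⟩} G(s) F(s) ds, the integrand on the right being absolutely integrable. -/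
open MeasureTheory RealInnerProductSpace

/-- Cylindrical splitting of Euclidean space along the direction of a nonzero vector. -/
lemma exists_measurableEquiv_axial {n : ℕ} {s : EuclideanSpace ℝ (Fin (n + 1))} (hs : s ≠ 0) :
    ∃ Φ : EuclideanSpace ℝ (Fin (n + 1)) ≃ᵐ ℝ × EuclideanSpace ℝ (Fin n),
      MeasurePreserving Φ ∧ ∀ z, ⟪s, z⟫ = ‖s‖ * (Φ z).1 ∧
        ‖z‖ = √((Φ z).1 ^ 2 + ‖(Φ z).2‖ ^ 2) := by
  have hs' : ‖s‖ ≠ 0 := norm_ne_zero_iff.2 hs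
  obtain ⟨b, hb⟩ := Orthonormal.exists_orthonormalBasis_extension_of_card_eq (𝕜 := ℝ)
    (E := EuclideanSpace ℝ (Fin (n + 1))) (ι := Fin (n + 1)) (by simp)
    (v := fun _ => ‖s‖⁻¹ • s) (s := {0}) (by
      rw [orthonormal_iff_ite]
      rintro ⟨i, rfl⟩ ⟨j, rfl⟩
      simp [Set.domRestrict, norm_smul, hs'])
  have hb0 : b 0 = ‖s‖⁻¹ • s := hb 0 rfl
  let e₁ : EuclideanSpace ℝ (Fin (n + 1)) ≃ᵐ EuclideanSpace ℝ (Fin (n + 1)) :=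
    b.repr.toHomeomorph.toMeasurableEquiv
  let e₂ := (MeasurableEquiv.toLp 2 (Fin (n + 1) → ℝ)).symm
  let e₃ := MeasurableEquiv.piFinSuccAbove (fun _ : Fin (n + 1) => ℝ) 0
  let e₄ := (MeasurableEquiv.refl ℝ).prodCongr (MeasurableEquiv.toLp 2 (Fin n → ℝ))
  refine ⟨((e₁.trans e₂).trans e₃).trans e₄, ?_, ?_⟩
  · have h₁ : MeasurePreserving e₁ := b.measurePreserving_repr
    have h₂ : MeasurePreserving e₂ :=
      EuclideanSpace.volume_preserving_symm_measurableEquiv_toLp _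
    have h₃ : MeasurePreserving e₃ := volume_preserving_piFinSuccAbove _ 0
    have h₄ : MeasurePreserving e₄ :=
      (MeasurePreserving.id volume).prod (PiLp.volume_preserving_toLp (Fin n))
    exact h₄.comp (h₃.comp (h₂.comp h₁))
  · intro z
    have h1 : ((((e₁.trans e₂).trans e₃).trans e₄) z).1 = b.repr z 0 := rfl
    have h2 : ∀ i, ((((e₁.trans e₂).trans e₃).trans e₄) z).2 i = b.repr z i.succ := fun _ => rfl
    constructor
    · rw [h1, b.repr_apply_apply, hb0, inner_smul_left]
      simp [hs']
    · rw [h1, ← b.repr.norm_map z, EuclideanSpace.norm_sq_eq, EuclideanSpace.norm_eq,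
        Fin.sum_univ_succ]
      simp only [h2, Real.norm_eq_abs, sq_abs]

/-- Radial profile of the outgoing Helmholtz kernel truncated at radius `L`. -/
noncomputable def truncKernel (k L r : ℝ) : ℂ :=
  if r ≤ L then Complex.exp (Complex.I * k * r) / ((4 * Real.pi * r : ℝ) : ℂ) else 0

/-- The truncated Helmholtz kernel integrated over the plane at height `a`. -/
noncomputable def axialKernel (k L a : ℝ) : ℂ :=
  if |a| ≤ L then (Complex.exp (Complex.I * k * L) - Complex.exp (Complex.I * k * |a|)) /
    (2 * Complex.I * k) else 0

lemma integrable_truncKernel (k : ℝ) {L : ℝ} :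
    Integrable fun z : EuclideanSpace ℝ (Fin 3) => truncKernel k L ‖z‖ := by
  rw [integrable_fun_norm_addHaar]
  simp only [finrank_euclideanSpace, Fintype.card_fin, Nat.add_one_sub_one]
  have h : IntegrableOn (fun r : ℝ => (r : ℂ) * Complex.exp (Complex.I * k * r) / (4 * Real.pi))
      (Set.Ioc 0 L) :=
    ((Continuous.integrableOn_Icc (by fun_prop)).mono_set Set.Ioc_subset_Icc_self)
  have h2 := (integrable_indicator_iff measurableSet_Ioc).2 h
  refine (h2.integrableOn (s := Set.Ioi 0)).congr_fun (fun r hr => ?_) measurableSet_Ioi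
  have hr' : (r : ℂ) ≠ 0 := by simpa using (ne_of_gt hr)
  have hr0 : 0 < r := hr
  have hpi : (Real.pi : ℂ) ≠ 0 := by simp
  by_cases hL : r ≤ L
  · simp only [Set.indicator, Set.mem_Ioc, hr0, hL, truncKernel, and_self, if_true]
    simp only [Complex.real_smul]
    push_cast
    field_simp
  · simp [Set.indicator, hL, truncKernel]

lemma integral_truncKernel_sqrt {k L a : ℝ} (hk : k ≠ 0) (hL : 0 < L) (ha : a ≠ 0) :
    ∫ w : EuclideanSpace ℝ (Fin 2), truncKernel k L √(a ^ 2 + ‖w‖ ^ 2) = axialKernel k L a := by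
  have hpi : (Real.pi : ℂ) ≠ 0 := by simp
  have hkc : (k : ℂ) ≠ 0 := by simpa using hk
  have hpos : ∀ y : ℝ, 0 < a ^ 2 + y ^ 2 := fun y => by positivity
  rw [integral_fun_norm_addHaar volume (fun y => truncKernel k L √(a ^ 2 + y ^ 2))]
  have hb : (volume : Measure (EuclideanSpace ℝ (Fin 2))).real (Metric.ball 0 1) = Real.pi := by
    simp [Measure.real, EuclideanSpace.volume_ball_fin_two, Real.pi_pos.le]
  rw [hb]
  simp only [finrank_euclideanSpace, Fintype.card_fin, Nat.add_one_sub_one, pow_one]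
  unfold axialKernel
  split_ifs with haL
  · have haL2 : a ^ 2 ≤ L ^ 2 := by rw [sq_le_sq]; rwa [abs_of_pos hL]
    set R := √(L ^ 2 - a ^ 2) with hR
    have hR0 : 0 ≤ R := Real.sqrt_nonneg _
    have hR2 : a ^ 2 + R ^ 2 = L ^ 2 := by rw [hR, Real.sq_sqrt (by linarith)]; ring
    have key : ∫ y in Set.Ioi (0 : ℝ), y • truncKernel k L √(a ^ 2 + y ^ 2) =
        ∫ y in (0 : ℝ)..R, (y : ℂ) * (Complex.exp (Complex.I * k * (√(a ^ 2 + y ^ 2) : ℝ)) /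
          ((4 * Real.pi * √(a ^ 2 + y ^ 2) : ℝ) : ℂ)) := by
      rw [intervalIntegral.integral_of_le hR0, ← integral_indicator measurableSet_Ioi,
        ← integral_indicator measurableSet_Ioc]
      congr 1
      ext y
      simp only [Set.indicator, Set.mem_Ioi, Set.mem_Ioc]
      by_cases hy : 0 < y
      · have : √(a ^ 2 + y ^ 2) ≤ L ↔ y ≤ R := by
          rw [Real.sqrt_le_left hL.le, ← hR2, add_le_add_iff_left, sq_le_sq₀ hy.le hR0]
        simp only [hy, true_and, if_true, truncKernel, this, Complex.real_smul]
        split_ifs <;> simp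
      · simp [hy]
    rw [key]
    have hd : ∀ y : ℝ, HasDerivAt (fun y : ℝ =>
        Complex.exp (Complex.I * k * (√(a ^ 2 + y ^ 2) : ℝ)) / (4 * Real.pi * Complex.I * k))
        ((y : ℂ) * (Complex.exp (Complex.I * k * (√(a ^ 2 + y ^ 2) : ℝ)) /
          ((4 * Real.pi * √(a ^ 2 + y ^ 2) : ℝ) : ℂ))) y := by
      intro y
      have h1 : HasDerivAt (fun y : ℝ => a ^ 2 + y ^ 2) (2 * y) y := by
        simpa using (hasDerivAt_pow 2 y).const_add (a ^ 2)
      have h2 := (((h1.sqrt (hpos y).ne').ofReal_comp).const_mul (Complex.I * k)).cexp.div_const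
        (4 * Real.pi * Complex.I * k)
      refine h2.congr_deriv ?_
      have : ((√(a ^ 2 + y ^ 2) : ℝ) : ℂ) ≠ 0 := by
        simpa using (Real.sqrt_pos.2 (hpos y)).ne'
      push_cast
      field_simp [Complex.I_ne_zero]
    rw [intervalIntegral.integral_eq_sub_of_hasDerivAt (fun y _ => hd y)]
    · rw [hR2, Real.sqrt_sq hL.le]
      simp only [ne_eq, OfNat.ofNat_ne_zero, not_false_eq_true, zero_pow, add_zero,
        Real.sqrt_sq_eq_abs, Complex.real_smul, nsmul_eq_mul]
      push_cast
      field_simp [Complex.I_ne_zero]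
      ring
    · apply Continuous.intervalIntegrable
      refine Continuous.mul (by fun_prop) (Continuous.div (by fun_prop) (by fun_prop) fun y => ?_)
      have := Real.sqrt_pos.2 (hpos y)
      have := Real.pi_pos
      exact_mod_cast (by positivity : 4 * Real.pi * √(a ^ 2 + y ^ 2) ≠ 0)
  · have : ∀ y : ℝ, truncKernel k L √(a ^ 2 + y ^ 2) = 0 := fun y => by
      rw [truncKernel, if_neg]
      contrapose! haL
      refine le_trans ?_ haL
      rw [← Real.sqrt_sq_eq_abs]
      exact Real.sqrt_le_sqrt (by nlinarith)
    simp [this]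

lemma integral_exp_mul_axialKernel {k L c : ℝ} (hk : 0 < k) (hL : 0 < L) (hc : 0 < c)
    (hck : c ≠ k) :
    ∫ a : ℝ, Complex.exp (-Complex.I * (c * a : ℝ)) * axialKernel k L a =
      (-1 + Complex.exp (Complex.I * (L : ℂ) * (k : ℂ)) *
          ((Real.cos (L * c) : ℂ) -
            Complex.I * ((k / c : ℝ) : ℂ) * (Real.sin (L * c) : ℂ))) /
        (((k - c) * (k + c) : ℝ) : ℂ) := by
  have hkc : (k : ℂ) ≠ 0 := by simpa using hk.ne'
  have hcc : (c : ℂ) ≠ 0 := by simpa using hc.ne'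
  have h1 : (k : ℂ) - c ≠ 0 := by rw [sub_ne_zero]; exact_mod_cast hck.symm
  have h2 : (k : ℂ) + c ≠ 0 := by exact_mod_cast (by positivity : k + c ≠ 0)
  have hI := Complex.I_ne_zero
  have hset : ∫ a : ℝ, Complex.exp (-Complex.I * (c * a : ℝ)) * axialKernel k L a =
      ∫ a in (-L)..L, Complex.exp (-Complex.I * (c * a : ℝ)) *
        ((Complex.exp (Complex.I * k * L) - Complex.exp (Complex.I * k * |a|)) /
          (2 * Complex.I * k)) := by
    rw [intervalIntegral.integral_of_le (by linarith), ← integral_Icc_eq_integral_Ioc,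
      ← integral_indicator measurableSet_Icc]
    congr 1
    ext a
    simp only [Set.indicator, Set.mem_Icc, axialKernel, abs_le]
    split_ifs <;> simp
  have hint : ∀ u v, IntervalIntegrable (fun a : ℝ => Complex.exp (-Complex.I * (c * a : ℝ)) *
        ((Complex.exp (Complex.I * k * L) - Complex.exp (Complex.I * k * |a|)) /
          (2 * Complex.I * k))) volume u v := fun u v =>
    Continuous.intervalIntegrable (by fun_prop) _ _
  have hneg := intervalIntegral.integral_comp_neg (a := 0) (b := L)
    (fun a : ℝ => Complex.exp (-Complex.I * (c * a : ℝ)) *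
        ((Complex.exp (Complex.I * k * L) - Complex.exp (Complex.I * k * |a|)) /
          (2 * Complex.I * k)))
  rw [neg_zero] at hneg
  rw [hset, ← intervalIntegral.integral_add_adjacent_intervals (hint _ 0) (hint _ _), ← hneg,
    ← intervalIntegral.integral_add
      (Continuous.intervalIntegrable (by fun_prop) _ _) (hint _ _)]
  have hexp : ∀ d : ℂ, ∀ u v, IntervalIntegrable (fun a : ℝ => Complex.exp (d * a)) volume u v :=
    fun d u v => Continuous.intervalIntegrable (by fun_prop) _ _
  have hcongr : ∀ a ∈ Set.uIcc 0 L, Complex.exp (-Complex.I * (c * -a : ℝ)) *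
        ((Complex.exp (Complex.I * k * L) - Complex.exp (Complex.I * k * |-a|)) /
          (2 * Complex.I * k)) + Complex.exp (-Complex.I * (c * a : ℝ)) *
        ((Complex.exp (Complex.I * k * L) - Complex.exp (Complex.I * k * |a|)) /
          (2 * Complex.I * k)) =
      (2 * Complex.I * k)⁻¹ * ((Complex.exp (Complex.I * k * L) *
        (Complex.exp (Complex.I * c * a) + Complex.exp (-(Complex.I * c) * a))) -
        (Complex.exp (Complex.I * (k + c) * a) + Complex.exp (Complex.I * (k - c) * a))) := by
    intro a ha
    rw [Set.uIcc_of_le hL.le] at ha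
    rw [abs_neg, abs_of_nonneg ha.1]
    have e1 : Complex.exp (Complex.I * (k + c) * a) =
        Complex.exp (Complex.I * k * a) * Complex.exp (Complex.I * c * a) := by
      rw [← Complex.exp_add]; ring_nf
    have e2 : Complex.exp (Complex.I * (k - c) * a) =
        Complex.exp (Complex.I * k * a) * Complex.exp (-(Complex.I * c) * a) := by
      rw [← Complex.exp_add]; ring_nf
    have e3 : -Complex.I * (c * -a : ℝ) = Complex.I * c * a := by push_cast; ring
    have e4 : -Complex.I * (c * a : ℝ) = -(Complex.I * c) * a := by push_cast; ring
    rw [e1, e2, e3, e4]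
    ring
  rw [intervalIntegral.integral_congr hcongr, intervalIntegral.integral_const_mul,
    intervalIntegral.integral_sub
      (((hexp _ _ _).add (hexp _ _ _)).const_mul _) ((hexp _ _ _).add (hexp _ _ _)),
    intervalIntegral.integral_const_mul,
    intervalIntegral.integral_add (hexp _ _ _) (hexp _ _ _),
    intervalIntegral.integral_add (hexp _ _ _) (hexp _ _ _),
    integral_exp_mul_complex (mul_ne_zero hI hcc),
    integral_exp_mul_complex (neg_ne_zero.2 (mul_ne_zero hI hcc)),
    integral_exp_mul_complex (mul_ne_zero hI h2), integral_exp_mul_complex (mul_ne_zero hI h1)]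
  have e1 : Complex.exp (Complex.I * (k + c) * L) =
      Complex.exp (Complex.I * L * k) * Complex.exp (Complex.I * c * L) := by
    rw [← Complex.exp_add]; ring_nf
  have e2 : Complex.exp (Complex.I * (k - c) * L) =
      Complex.exp (Complex.I * L * k) * Complex.exp (-(Complex.I * c) * L) := by
    rw [← Complex.exp_add]; ring_nf
  have e3 : Complex.exp (Complex.I * k * L) = Complex.exp (Complex.I * L * k) := by ring_nf
  have e4 : Complex.exp (Complex.I * c * L) =
      Complex.cos (L * c) + Complex.sin (L * c) * Complex.I := by
    rw [← Complex.exp_mul_I]; ring_nf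
  have e5 : Complex.exp (-(Complex.I * c) * L) =
      Complex.cos (L * c) - Complex.sin (L * c) * Complex.I := by
    have := Complex.exp_mul_I (-(L * c : ℂ))
    rw [Complex.cos_neg, Complex.sin_neg, neg_mul] at this
    rw [sub_eq_add_neg, ← neg_mul (Complex.sin _), ← this]; ring_nf
  rw [e1, e2, e3, e4, e5]
  push_cast
  simp only [mul_zero, Complex.exp_zero]
  field_simp
  ring_nf
  simp only [Complex.I_sq, show Complex.I ^ 3 = -Complex.I by rw [pow_succ, Complex.I_sq]; ring]
  ring

/-- The Fourier transform of the truncated Helmholtz kernel. -/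
lemma integral_truncKernel_mul_exp {k L : ℝ} (hk : 0 < k) (hL : 0 < L)
    {s : EuclideanSpace ℝ (Fin 3)} (hs : ‖s‖ ≠ 0) (hsk : ‖s‖ ≠ k) :
    ∫ z : EuclideanSpace ℝ (Fin 3),
        Complex.exp (-Complex.I * (⟪s, z⟫ : ℂ)) * truncKernel k L ‖z‖ =
      (-1 + Complex.exp (Complex.I * (L : ℂ) * (k : ℂ)) *
          ((Real.cos (L * ‖s‖) : ℂ) -
            Complex.I * ((k / ‖s‖ : ℝ) : ℂ) * (Real.sin (L * ‖s‖) : ℂ))) /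
        (((k - ‖s‖) * (k + ‖s‖) : ℝ) : ℂ) := by
  obtain ⟨Φ, hΦ, h⟩ := exists_measurableEquiv_axial (norm_ne_zero_iff.1 hs)
  let g : ℝ × EuclideanSpace ℝ (Fin 2) → ℂ := fun p =>
    Complex.exp (-Complex.I * (‖s‖ * p.1 : ℝ)) * truncKernel k L √(p.1 ^ 2 + ‖p.2‖ ^ 2)
  have hg : ∀ z, Complex.exp (-Complex.I * (⟪s, z⟫ : ℂ)) * truncKernel k L ‖z‖ = g (Φ z) := by
    intro z
    simp only [g, ← (h z).1, ← (h z).2]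
  have hgi : Integrable g := by
    rw [← hΦ.integrable_comp_emb Φ.measurableEmbedding]
    refine ((integrable_truncKernel k (L := L)).bdd_mul (c := 1)
      (f := fun z => Complex.exp (-Complex.I * (⟪s, z⟫ : ℂ)))
      (Continuous.aestronglyMeasurable (by fun_prop)) ?_).congr ?_
    · refine Filter.Eventually.of_forall fun z => ?_
      simp [Complex.norm_exp]
    · exact Filter.Eventually.of_forall hg
  simp_rw [hg]
  rw [hΦ.integral_comp' g, Measure.volume_eq_prod, integral_prod g hgi]
  simp only [g, integral_const_mul]
  rw [← integral_exp_mul_axialKernel hk hL (lt_of_le_of_ne (norm_nonneg s) hs.symm) hsk]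
  refine integral_congr_ae ?_
  have h0 : ∀ᵐ a : ℝ, a ≠ 0 := by simp [ae_iff]
  filter_upwards [h0] with a ha
  rw [integral_truncKernel_sqrt hk.ne' hL ha]

/-- Fourier inversion in the angular-frequency normalization. -/
lemma fourier_inversion_angular {f : EuclideanSpace ℝ (Fin 3) → ℂ}
    (hf : ContDiff ℝ (⊤ : ℕ∞) f) (hc : HasCompactSupport f)
    {F : EuclideanSpace ℝ (Fin 3) → ℂ}
    (hF : ∀ s, F s = ∫ y, Complex.exp (-Complex.I * (⟪s, y⟫ : ℂ)) * f y) :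
    Integrable F ∧ ∀ y, f y = ((1 / (2 * Real.pi) ^ 3 : ℝ) : ℂ) *
      ∫ s, Complex.exp (Complex.I * (⟪s, y⟫ : ℂ)) * F s := by
  have hpi : Real.pi ≠ 0 := Real.pi_ne_zero
  have hc0 : (2 * Real.pi)⁻¹ ≠ 0 := by positivity
  have hFF : ∀ s, F s = FourierTransform.fourier f ((2 * Real.pi)⁻¹ • s) := by
    intro s
    rw [hF, Real.fourier_eq']
    congr 1
    ext y
    rw [inner_smul_right, smul_eq_mul, real_inner_comm y s]
    congr 2
    push_cast
    have : (Real.pi : ℂ) ≠ 0 := by exact_mod_cast hpi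
    field_simp
  have hint : Integrable (FourierTransform.fourier f) := by
    have h := (FourierTransform.fourier (hc.toSchwartzMap hf)).integrable (μ := volume)
    rw [SchwartzMap.fourier_coe] at h
    exact h
  refine ⟨(hint.comp_smul hc0).congr (Filter.Eventually.of_forall fun s => (hFF s).symm),
    fun y => ?_⟩
  have hinv := congrFun (hf.continuous.fourierInv_fourier_eq
    (hf.continuous.integrable_of_hasCompactSupport hc) hint) y
  rw [Real.fourierInv_eq'] at hinv
  have hsc := Measure.integral_comp_smul (volume : Measure (EuclideanSpace ℝ (Fin 3)))
    (fun v => Complex.exp (((2 * Real.pi * ⟪v, y⟫ : ℝ) : ℂ) * Complex.I) •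
      FourierTransform.fourier f v) (2 * Real.pi)⁻¹
  rw [hinv] at hsc
  have hcongr : ∀ s, Complex.exp (Complex.I * (⟪s, y⟫ : ℂ)) * F s =
      Complex.exp (((2 * Real.pi * ⟪(2 * Real.pi)⁻¹ • s, y⟫ : ℝ) : ℂ) * Complex.I) •
        FourierTransform.fourier f ((2 * Real.pi)⁻¹ • s) := by
    intro s
    rw [hFF, smul_eq_mul, real_inner_smul_left, mul_inv_cancel_left₀ (by positivity),
      mul_comm Complex.I]
  simp_rw [hcongr]
  rw [hsc, finrank_euclideanSpace, Fintype.card_fin, abs_of_pos (by positivity),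
    Complex.real_smul, ← mul_assoc, ← Complex.ofReal_mul]
  rw [show 1 / (2 * Real.pi) ^ 3 * (((2 * Real.pi)⁻¹ ^ 3)⁻¹) = 1 by field_simp]
  simp

lemma norm_sub_le_sqrt_three {x y : EuclideanSpace ℝ (Fin 3)}
    (hx : ∀ i, x i ∈ Set.Icc (-(1 / 2) : ℝ) (1 / 2))
    (hy : ∀ i, y i ∈ Set.Icc (-(1 / 2) : ℝ) (1 / 2)) : ‖x - y‖ ≤ √3 := by
  rw [EuclideanSpace.norm_eq]
  refine Real.sqrt_le_sqrt ?_
  have : ∀ i, ‖(x - y) i‖ ^ 2 ≤ 1 := fun i => by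
    have h1 := hx i
    have h2 := hy i
    rw [Real.norm_eq_abs, sq_abs, PiLp.sub_apply, sq_le_one_iff_abs_le_one, abs_le]
    constructor <;> linarith [h1.1, h1.2, h2.1, h2.2]
  calc ∑ i, ‖(x - y) i‖ ^ 2 ≤ ∑ _i : Fin 3, (1 : ℝ) := Finset.sum_le_sum fun i _ => this i
    _ = 3 := by simp

/-- Spectral representation of the Helmholtz volume potential on the unit box using the
truncated kernel: for smooth `f` supported in `D = [-1/2,1/2]³`, `L > √3` and `k > 0`,
with `G(s) = (−1 + e^{iLk}(cos(L|s|) − i(k/|s|) sin(L|s|)))/((k−|s|)(k+|s|))`, for all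
`x ∈ D`,
`∫_D (e^{ik|x−y|}/(4π|x−y|)) f(y) dy = (1/(2π)³) ∫_{ℝ³} e^{i⟨s,x⟩} G(s) F(s) ds`,
the integrand on the right being absolutely integrable. -/
theorem stmt_12 (L k : ℝ) (hL : Real.sqrt 3 < L) (hk : 0 < k)
    (D : Set (EuclideanSpace ℝ (Fin 3)))
    (hD : D = {y : EuclideanSpace ℝ (Fin 3) | ∀ i, y i ∈ Set.Icc (-(1 / 2) : ℝ) (1 / 2)})
    (f : EuclideanSpace ℝ (Fin 3) → ℂ)
    (hf : ContDiff ℝ (⊤ : ℕ∞) f) (hsupp : Function.support f ⊆ D)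
    (F : EuclideanSpace ℝ (Fin 3) → ℂ)
    (hF : ∀ s, F s = ∫ y, Complex.exp (-Complex.I * (⟪s, y⟫ : ℂ)) * f y)
    (G : EuclideanSpace ℝ (Fin 3) → ℂ)
    (hG : ∀ s, ‖s‖ ≠ 0 → ‖s‖ ≠ k →
      G s = (-1 + Complex.exp (Complex.I * (L : ℂ) * (k : ℂ)) *
          ((Real.cos (L * ‖s‖) : ℂ) -
            Complex.I * ((k / ‖s‖ : ℝ) : ℂ) * (Real.sin (L * ‖s‖) : ℂ))) /
        (((k - ‖s‖) * (k + ‖s‖) : ℝ) : ℂ))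
    (x : EuclideanSpace ℝ (Fin 3)) (hx : x ∈ D) :
    Integrable (fun s : EuclideanSpace ℝ (Fin 3) =>
        Complex.exp (Complex.I * (⟪s, x⟫ : ℂ)) * G s * F s) ∧
    ∫ y in D, Complex.exp (Complex.I * (k : ℂ) * (‖x - y‖ : ℂ)) /
          ((4 * Real.pi * ‖x - y‖ : ℝ) : ℂ) * f y =
      ((1 / (2 * Real.pi) ^ 3 : ℝ) : ℂ) *
        ∫ s, Complex.exp (Complex.I * (⟪s, x⟫ : ℂ)) * G s * F s := by
  have hL0 : 0 < L := (Real.sqrt_nonneg 3).trans_lt hL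
  have hDc : IsClosed D := by
    rw [hD, Set.ofPred_forall]
    exact isClosed_iInter fun i => isClosed_Icc.preimage (by fun_prop)
  have hDb : ∀ y ∈ D, ‖x - y‖ ≤ L := fun y hy => by
    rw [hD] at hx hy
    exact (norm_sub_le_sqrt_three hx hy).trans hL.le
  have hc : HasCompactSupport f := by
    refine HasCompactSupport.of_support_subset_isCompact
      (isCompact_closedBall x L) (hsupp.trans fun y hy => ?_)
    rw [Metric.mem_closedBall, dist_comm, dist_eq_norm]
    exact hDb y hy
  obtain ⟨hFi, hinv⟩ := fourier_inversion_angular hf hc hF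
  let H : EuclideanSpace ℝ (Fin 3) → EuclideanSpace ℝ (Fin 3) → ℂ := fun z s =>
    truncKernel k L ‖z‖ * (Complex.exp (Complex.I * (⟪s, x - z⟫ : ℂ)) * F s)
  have hH : Integrable (Function.uncurry H) (volume.prod volume) := by
    refine (((integrable_truncKernel k (L := L)).mul_prod hFi).bdd_mul (c := 1)
      (f := fun p : EuclideanSpace ℝ (Fin 3) × EuclideanSpace ℝ (Fin 3) =>
        Complex.exp (Complex.I * (⟪p.2, x - p.1⟫ : ℂ)))
      (Continuous.aestronglyMeasurable (by fun_prop)) ?_).congr ?_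
    · refine Filter.Eventually.of_forall fun z => ?_
      simp [Complex.norm_exp]
    · refine Filter.Eventually.of_forall fun p => ?_
      simp only [H, Function.uncurry]
      ring
  have hHs : ∀ s, ∫ z, H z s = Complex.exp (Complex.I * (⟪s, x⟫ : ℂ)) *
      (∫ z : EuclideanSpace ℝ (Fin 3),
        Complex.exp (-Complex.I * (⟪s, z⟫ : ℂ)) * truncKernel k L ‖z‖) * F s := by
    intro s
    rw [← integral_const_mul, ← integral_mul_const]
    congr 1
    ext z
    have : Complex.exp (Complex.I * (⟪s, x - z⟫ : ℂ)) =
        Complex.exp (Complex.I * (⟪s, x⟫ : ℂ)) * Complex.exp (-Complex.I * (⟪s, z⟫ : ℂ)) := by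
      rw [← Complex.exp_add, inner_sub_right]
      push_cast
      ring_nf
    simp only [H, this]
    ring
  have hae : (fun s => ∫ z, H z s) =ᵐ[volume]
      fun s => Complex.exp (Complex.I * (⟪s, x⟫ : ℂ)) * G s * F s := by
    have h0 : ∀ r : ℝ, ∀ᵐ s : EuclideanSpace ℝ (Fin 3), ‖s‖ ≠ r := fun r => by
      rw [ae_iff]
      convert Measure.addHaar_sphere volume (0 : EuclideanSpace ℝ (Fin 3)) r using 2
      ext s
      simp
    filter_upwards [h0 0, h0 k] with s hs hsk
    rw [hHs, integral_truncKernel_mul_exp hk hL0 hs hsk, hG s hs hsk]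
  refine ⟨hH.integral_prod_right.congr hae, ?_⟩
  rw [← integral_congr_ae hae, ← integral_integral_swap hH, ← integral_const_mul,
    ← integral_indicator hDc.measurableSet,
    ← integral_sub_left_eq_self (μ := volume)
      (fun z => ((1 / (2 * Real.pi) ^ 3 : ℝ) : ℂ) * ∫ s, H z s) x]
  congr 1
  ext y
  simp only [H, sub_sub_cancel, integral_const_mul]
  rw [mul_left_comm, ← hinv y]
  by_cases hy : y ∈ D
  · rw [Set.indicator_of_mem hy, truncKernel, if_pos (hDb y hy)]
  · rw [Set.indicator_of_notMem hy, Function.notMem_support.1 fun h => hy (hsupp h), mul_zero]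
end
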